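/- arXiv:2310.15207 — 3 statements merged into one kernel-verified Lean document; each statement's English description precedes it below -/
import Mathlib

section
/- Let p ≡ 1 (mod 4) be a prime and r a positive integer with r > 1. Then Γ_p((2p^r+1)/4) / Γ_p((2p^r+3)/4) ≡ (-1)^{(p+3)/4} · Γ_p(1/4)^2 (mod p^{2r}). -/
open Finset

/-- Functional equation at naturals. -/
lemma feq_nat (p : ℕ) [Fact p.Prime] (G : ℤ_[p] → ℤ_[p])
    (hGval : ∀ n : ℕ, G n =
      (-1) ^ n * ∏ k ∈ (Finset.range n).filter (fun k => ¬ p ∣ k), (k : ℤ_[p])) (n : ℕ) :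
    G ((n : ℤ_[p]) + 1) = (if p ∣ n then -1 else -(n : ℤ_[p])) * G n := by
  have h := hGval (n + 1)
  rw [Finset.range_add_one, Finset.filter_insert] at h
  push_cast at h
  rw [h, hGval n]
  by_cases h1 : p ∣ n
  · simp only [h1, not_true_eq_false, if_true, if_false]
    ring
  · simp only [h1, not_false_eq_true, if_true, if_false]
    rw [Finset.prod_insert (by simp)]
    ring

lemma feq (p : ℕ) [Fact p.Prime] (G : ℤ_[p] → ℤ_[p]) (hGcont : Continuous G)
    (hGval : ∀ n : ℕ, G n =
      (-1) ^ n * ∏ k ∈ (Finset.range n).filter (fun k => ¬ p ∣ k), (k : ℤ_[p]))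
    (j : ℕ) (y : ℤ_[p]) :
    G ((j + p * y : ℤ_[p]) + 1) =
      (if p ∣ j then -1 else -(j + p * y : ℤ_[p])) * G (j + p * y) := by
  refine PadicInt.denseRange_natCast.induction_on (p := fun y : ℤ_[p] =>
    G ((j + p * y : ℤ_[p]) + 1) =
      (if p ∣ j then -1 else -(j + p * y : ℤ_[p])) * G (j + p * y)) y ?_ ?_
  · split_ifs
    · exact isClosed_eq (by fun_prop) (by fun_prop)
    · exact isClosed_eq (by fun_prop) (by fun_prop)
  · intro m
    have h := feq_nat p G hGval (j + p * m)
    simp only [Nat.dvd_add_left (dvd_mul_right p m)] at h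
    push_cast at h
    exact h

lemma decomp (p : ℕ) [Fact p.Prime] (x : ℤ_[p]) : ∃ (j : ℕ) (y : ℤ_[p]), x = j + p * y := by
  have h := PadicInt.appr_spec 1 x
  rw [pow_one, Ideal.mem_span_singleton] at h
  obtain ⟨y, hy⟩ := h
  exact ⟨x.appr 1, y, by rw [← hy]; ring⟩

/-- Functional equation, unit case and non-unit case. -/
lemma feq_zero (p : ℕ) [Fact p.Prime] (G : ℤ_[p] → ℤ_[p]) (hGcont : Continuous G)
    (hGval : ∀ n : ℕ, G n =
      (-1) ^ n * ∏ k ∈ (Finset.range n).filter (fun k => ¬ p ∣ k), (k : ℤ_[p]))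
    (x : ℤ_[p]) (hx : (p : ℤ_[p]) ∣ x) : G (x + 1) = - G x := by
  obtain ⟨y, rfl⟩ := hx
  simpa using feq p G hGcont hGval 0 y

lemma feq_unit (p : ℕ) [Fact p.Prime] (G : ℤ_[p] → ℤ_[p]) (hGcont : Continuous G)
    (hGval : ∀ n : ℕ, G n =
      (-1) ^ n * ∏ k ∈ (Finset.range n).filter (fun k => ¬ p ∣ k), (k : ℤ_[p]))
    (x : ℤ_[p]) (hx : ¬ (p : ℤ_[p]) ∣ x) : G (x + 1) = - x * G x := by
  obtain ⟨j, y, rfl⟩ := decomp p x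
  have h := feq p G hGcont hGval j y
  rwa [if_neg] at h
  rintro ⟨k, rfl⟩
  apply hx
  push_cast
  exact ⟨k + y, by ring⟩

lemma R_step (p : ℕ) [Fact p.Prime] (G : ℤ_[p] → ℤ_[p]) (hGcont : Continuous G)
    (hGval : ∀ n : ℕ, G n =
      (-1) ^ n * ∏ k ∈ (Finset.range n).filter (fun k => ¬ p ∣ k), (k : ℤ_[p]))
    (x : ℤ_[p]) :
    ((p : ℤ_[p]) ∣ x → G (x + 1) * G (1 - (x + 1)) = G x * G (1 - x)) ∧
    (¬ (p : ℤ_[p]) ∣ x → G (x + 1) * G (1 - (x + 1)) = - (G x * G (1 - x))) := by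
  have e1 : 1 - (x + 1) = -x := by ring
  have e2 : 1 - x = -x + 1 := by ring
  rw [e1, e2]
  constructor
  · intro h
    rw [feq_zero p G hGcont hGval x h, feq_zero p G hGcont hGval (-x) ((dvd_neg).2 h)]
    ring
  · intro h
    rw [feq_unit p G hGcont hGval x h,
      feq_unit p G hGcont hGval (-x) (fun h' => h ((dvd_neg).1 h'))]
    ring

lemma R_nat (p : ℕ) [Fact p.Prime] (hp4 : p % 4 = 1) (G : ℤ_[p] → ℤ_[p])
    (hGcont : Continuous G)
    (hGval : ∀ n : ℕ, G n =
      (-1) ^ n * ∏ k ∈ (Finset.range n).filter (fun k => ¬ p ∣ k), (k : ℤ_[p]))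
    (m : ℕ) : G ((p : ℤ_[p]) * m) * G (1 - p * m) = -1 ∧ ∀ j : ℕ, j + 1 ≤ p →
      G ((j + 1 : ℕ) + p * m) * G (1 - ((j + 1 : ℕ) + p * m)) = (-1) ^ (j + 1) := by
  have key : ∀ m : ℕ, G ((p : ℤ_[p]) * m) * G (1 - p * m) = -1 → ∀ j : ℕ, j + 1 ≤ p →
      G ((j + 1 : ℕ) + p * m) * G (1 - ((j + 1 : ℕ) + p * m)) = (-1) ^ (j + 1) := by
    intro m hm j
    induction j with
    | zero =>
      intro _
      have h := (R_step p G hGcont hGval ((p : ℤ_[p]) * m)).1 (dvd_mul_right _ _)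
      rw [hm] at h
      rw [add_comm] at h
      simpa using h
    | succ j ih =>
      intro hj
      have h := (R_step p G hGcont hGval ((j + 1 : ℕ) + (p : ℤ_[p]) * m)).2 (by
        intro hd
        have h2 : (p : ℤ_[p]) ∣ ((j + 1 : ℕ) : ℤ_[p]) :=
          (dvd_add_left (dvd_mul_right _ _)).1 hd
        have h3 : ‖(((j + 1 : ℕ) : ℤ) : ℤ_[p])‖ < 1 := by
          have := PadicInt.norm_lt_one_iff_dvd (p := p) (((j + 1 : ℕ)) : ℤ_[p])
          exact_mod_cast this.2 h2
        rw [PadicInt.norm_int_lt_one_iff_dvd] at h3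
        have h4 : p ∣ j + 1 := by exact_mod_cast h3
        have := Nat.le_of_dvd (by omega) h4
        omega)
      rw [ih (by omega)] at h
      have e : ((j + 1 + 1 : ℕ) : ℤ_[p]) + p * m = ((j + 1 : ℕ) : ℤ_[p]) + p * m + 1 := by
        push_cast; ring
      rw [e, h]
      ring
  have hpos : 0 < p := (Fact.out : p.Prime).pos
  have base : ∀ m : ℕ, G ((p : ℤ_[p]) * m) * G (1 - p * m) = -1 := by
    intro m
    induction m with
    | zero =>
      have h0 := hGval 0
      have h1 := hGval 1
      simp [Finset.filter_singleton] at h0 h1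
      simp [h0, h1]
    | succ m ih =>
      have h := key m ih (p - 1) (by omega)
      have e : p - 1 + 1 = p := by omega
      rw [e] at h
      have e2 : (p : ℤ_[p]) * ((m + 1 : ℕ) : ℤ_[p]) = p + p * m := by push_cast; ring
      rw [e2, h]
      exact Odd.neg_one_pow (Nat.odd_iff.2 (by omega))
  exact ⟨base m, key m (base m)⟩

lemma R_all (p : ℕ) [Fact p.Prime] (hp4 : p % 4 = 1) (G : ℤ_[p] → ℤ_[p])
    (hGcont : Continuous G)
    (hGval : ∀ n : ℕ, G n =
      (-1) ^ n * ∏ k ∈ (Finset.range n).filter (fun k => ¬ p ∣ k), (k : ℤ_[p]))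
    (j : ℕ) (hj : 1 ≤ j) (hjp : j ≤ p) (y : ℤ_[p]) :
    G (j + p * y) * G (1 - (j + p * y)) = (-1) ^ j := by
  refine PadicInt.denseRange_natCast.induction_on (p := fun y : ℤ_[p] =>
    G (j + p * y) * G (1 - (j + p * y)) = (-1) ^ j) y ?_ ?_
  · exact isClosed_eq (by fun_prop) (by fun_prop)
  · intro m
    obtain ⟨i, rfl⟩ : ∃ i, j = i + 1 := ⟨j - 1, by omega⟩
    exact (R_nat p hp4 G hGcont hGval m).2 i hjp

lemma prod_congr_sq (p : ℕ) [Fact p.Prime] (hp4 : p % 4 = 1) (r : ℕ) (hr : 1 < r)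
    (G : ℤ_[p] → ℤ_[p]) (hGcont : Continuous G)
    (hGval : ∀ n : ℕ, G n =
      (-1) ^ n * ∏ k ∈ (Finset.range n).filter (fun k => ¬ p ∣ k), (k : ℤ_[p]))
    (t x : ℤ_[p]) :
    ‖G (x + p ^ r * t) * G (x - p ^ r * t) - G x ^ 2‖ ≤ (p : ℝ) ^ (-((2 * r : ℕ) : ℤ)) := by
  have hpos : 0 < p := (Fact.out : p.Prime).pos
  obtain ⟨s, rfl⟩ : ∃ s, r = s + 1 := ⟨r - 1, by omega⟩
  set h : ℤ_[p] := p ^ (s + 1) * t with hh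
  have hph : (p : ℤ_[p]) ∣ h := ⟨p ^ s * t, by rw [hh]; ring⟩
  refine PadicInt.denseRange_natCast.induction_on (p := fun x : ℤ_[p] =>
    ‖G (x + h) * G (x - h) - G x ^ 2‖ ≤ (p : ℝ) ^ (-((2 * (s + 1) : ℕ) : ℤ))) x ?_ ?_
  · exact isClosed_le (by fun_prop) (by fun_prop)
  · intro n
    rw [PadicInt.norm_le_pow_iff_mem_span_pow, Ideal.mem_span_singleton]
    induction n with
    | zero =>
      have h0 := hGval 0
      simp at h0
      have h1 := R_all p hp4 G hGcont hGval p hpos le_rfl (p ^ s * t - 1)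
      have e : (p : ℤ_[p]) + p * (p ^ s * t - 1) = h := by rw [hh]; ring
      rw [e, Odd.neg_one_pow (Nat.odd_iff.2 (by omega)),
        show 1 - h = -h + 1 by ring, feq_zero p G hGcont hGval (-h) ((dvd_neg).2 hph)] at h1
      have h2 : G h * G (-h) = 1 := by linear_combination -h1
      simp [h0, h2]
    | succ n ih =>
      have e1 : ((n + 1 : ℕ) : ℤ_[p]) + h = (n + h) + 1 := by push_cast; ring
      have e2 : ((n + 1 : ℕ) : ℤ_[p]) - h = (n - h) + 1 := by push_cast; ring
      have e3 : ((n + 1 : ℕ) : ℤ_[p]) = n + 1 := by push_cast; ring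
      rw [e1, e2, e3]
      by_cases hn : (p : ℤ_[p]) ∣ n
      · rw [feq_zero p G hGcont hGval _ hn, feq_zero p G hGcont hGval _ (dvd_add hn hph),
          feq_zero p G hGcont hGval _ (dvd_sub hn hph)]
        convert ih using 1
        ring
      · rw [feq_unit p G hGcont hGval _ hn,
          feq_unit p G hGcont hGval _ (fun h' => hn ((dvd_add_left hph).1 h')),
          feq_unit p G hGcont hGval _ (fun h' => hn ((dvd_sub_left hph).1 h'))]
        obtain ⟨c, hc⟩ := ih
        refine ⟨n ^ 2 * c - t ^ 2 * (G (n + h) * G (n - h)), ?_⟩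
        have hsq : h ^ 2 = p ^ (2 * (s + 1)) * t ^ 2 := by rw [hh]; ring
        linear_combination (n : ℤ_[p]) ^ 2 * hc - (G (n + h) * G (n - h)) * hsq

/-- for a prime `p ≡ 1 (mod 4)` and `r > 1`,
`Γₚ((2p^r+1)/4)/Γₚ((2p^r+3)/4) ≡ (-1)^{(p+3)/4}·Γₚ(1/4)² (mod p^{2r})`, where
Morita's p-adic Gamma function is the continuous `G : ℤ_p → ℤ_p` with
`G(n) = (-1)^n ∏_{0<k<n, p∤k} k`, and `(2p^r+1)/4`, `(2p^r+3)/4`, `1/4` are the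
elements of `ℤ_p` determined by multiplication by `4`. -/
theorem stmt8 (p : ℕ) [Fact p.Prime] (hp4 : p % 4 = 1) (r : ℕ) (hr : 1 < r)
    (G : ℤ_[p] → ℤ_[p]) (hGcont : Continuous G)
    (hGval : ∀ n : ℕ, G n =
      (-1) ^ n * ∏ k ∈ (Finset.range n).filter (fun k => ¬ p ∣ k), (k : ℤ_[p]))
    (x₁ x₃ quarter : ℤ_[p])
    (hx₁ : 4 * x₁ = 2 * (p : ℤ_[p]) ^ r + 1)
    (hx₃ : 4 * x₃ = 2 * (p : ℤ_[p]) ^ r + 3)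
    (hquarter : 4 * quarter = 1) :
    ‖(G x₁ : ℚ_[p]) / (G x₃ : ℚ_[p])
        - (-1) ^ ((p + 3) / 4) * (G quarter : ℚ_[p]) ^ 2‖ ≤ (p : ℝ) ^ (-(2 * r : ℤ)) := by
  have hone : quarter * 4 = 1 := by rw [mul_comm]; exact hquarter
  have h4 : (4 : ℤ_[p]) ≠ 0 := by
    intro h; rw [h] at hquarter; simp at hquarter
  obtain ⟨s, rfl⟩ : ∃ s, r = s + 1 := ⟨r - 1, by omega⟩
  have hp1 : 1 < p := (Fact.out : p.Prime).one_lt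
  have hj : 4 * ((p + 3) / 4) = p + 3 := by omega
  have hj' : (4 : ℤ_[p]) * (((p + 3) / 4 : ℕ) : ℤ_[p]) = p + 3 := by exact_mod_cast hj
  set j := (p + 3) / 4 with hjdef
  have e1 : x₁ = quarter + p ^ (s + 1) * (2 * quarter) := by
    apply mul_left_cancel₀ h4
    linear_combination hx₁ - hquarter - 2 * p ^ (s + 1) * hquarter
  have e3 : 1 - x₃ = quarter - p ^ (s + 1) * (2 * quarter) := by
    apply mul_left_cancel₀ h4
    linear_combination - hx₃ - hquarter + 2 * p ^ (s + 1) * hquarter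
  have e3' : x₃ = j + p * (quarter * (2 * p ^ s - 1)) := by
    apply mul_left_cancel₀ h4
    linear_combination hx₃ - hj' - (2 * p ^ s - 1) * p * hquarter
  have hR := R_all p hp4 G hGcont hGval j (by omega) (by omega) (quarter * (2 * p ^ s - 1))
  rw [← e3'] at hR
  have hK := prod_congr_sq p hp4 (s + 1) hr G hGcont hGval (2 * quarter) quarter
  rw [← e1, ← e3] at hK
  have hsq : ((-1 : ℤ_[p]) ^ j) * (-1) ^ j = 1 := by
    rw [← mul_pow]; simp
  have hne : G x₃ ≠ 0 := by
    intro h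
    rw [h, zero_mul] at hR
    rw [← hR] at hsq
    simp at hsq
  have hne' : (G x₃ : ℚ_[p]) ≠ 0 := fun h => hne (Subtype.ext h)
  have hdiv : (G x₁ : ℚ_[p]) / (G x₃ : ℚ_[p]) = (-1) ^ j * ((G x₁ : ℚ_[p]) * G (1 - x₃)) := by
    rw [div_eq_iff hne']
    have : G x₁ = (-1) ^ j * (G x₁ * G (1 - x₃)) * G x₃ := by
      linear_combination -(-1) ^ j * G x₁ * hR - G x₁ * hsq
    exact_mod_cast congrArg (fun z : ℤ_[p] => (z : ℚ_[p])) this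
  rw [hdiv, ← mul_sub, norm_mul, norm_pow, norm_neg, norm_one, one_pow, one_mul]
  rw [PadicInt.norm_def] at hK
  push_cast at hK
  push_cast
  exact hK
end

section
/- Let m and n be positive integers with n ≡ 1 (mod 4). Then, modulo Φ_n(q), the truncated sum ∑_{k=0}^{mn-1} (q;q^2)_k^2 (q^2;q^4)_k / ((q^2;q^2)_k^2 (q^4;q^4)_k) · q^{2k} is congruent to [n]_q · (q^3;q^4)_{(n-1)/2}/(q^5;q^4)_{(n-1)/2} · ∑_{k=0}^{m-1} (1/2)_k^3 / k!^3, where the rational-number sum ∑_{k=0}^{m-1} (1/2)_k^3/k!^3 is viewed as a constant (its denominator being coprime to Φ_n(q) after reduction). -/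
open Finset Polynomial

/-- The q-shifted factorial `(a;Q)_k` in `ℚ(q)`. -/
noncomputable def poch (a Q : RatFunc ℚ) (k : ℕ) : RatFunc ℚ :=
  ∏ i ∈ Finset.range k, (1 - a * Q ^ i)

/-- The q-integer `[n]_q`. -/
noncomputable def qint (n : ℕ) : RatFunc ℚ :=
  (1 - RatFunc.X ^ n) / (1 - RatFunc.X)

/-- The rational rising factorial `(a)_k`. -/
def ascRat (a : ℚ) (k : ℕ) : ℚ := ∏ i ∈ Finset.range k, (a + i)


section Watson
variable {K : Type*} [Field K]

/-- Summand of the Watson-type sum, with `y = 1/x`. -/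
noncomputable def wF (p y x : K) (r : ℕ) : K :=
  ∏ i ∈ Finset.range r, ((1 - y * p ^ i) * (1 - x * p ^ (i+1)) * ((1 - p ^ (2*i+1)) * p /
    ((1 - p ^ (i+1)) ^ 2 * (1 - p ^ (2*i+2)))))

lemma wF_succ (p y x : K) (r : ℕ) : wF p y x (r+1) = wF p y x r *
    ((1 - y * p ^ r) * (1 - x * p ^ (r+1)) * ((1 - p ^ (2*r+1)) * p /
    ((1 - p ^ (r+1)) ^ 2 * (1 - p ^ (2*r+2))))) := Finset.prod_range_succ _ _

lemma wF_shift1 (p x : K) (hp : p ≠ 0) (hx : x ≠ 0) (r : ℕ) :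
    wF p x⁻¹ x r * ((1 - p^2*x) * (1 - p*x)) =
      wF p (p^2*x)⁻¹ x r * ((p^2*x - p^r) * (p*x - p^r)) := by
  induction r with
  | zero => simp [wF]; ring
  | succ r ih =>
    rw [wF_succ, wF_succ]
    generalize ((1 - p ^ (2*r+1)) * p / ((1 - p ^ (r+1)) ^ 2 * (1 - p ^ (2*r+2)))) = c at *
    generalize wF p (p^2*x)⁻¹ x r = A at *
    generalize wF p x⁻¹ x r = B at *
    have e1 : (1 - x⁻¹ * p ^ r) = (x - p^r) / x := by field_simp
    have e2 : (1 - (p^2*x)⁻¹ * p ^ r) = (p^2 * x - p^r) / (p^2*x) := by field_simp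
    rw [e1, e2]
    field_simp
    rw [show p^(r+1) = p^r * p from pow_succ _ _]
    linear_combination (p^2 * c * (x - p^r) * (1 - x * (p^r*p))) * ih

lemma wF_shift2 (p x : K) (r : ℕ) :
    wF p (p^2*x)⁻¹ (p^2*x) r * ((1 - p*x) * (1 - p^2*x)) =
      wF p (p^2*x)⁻¹ x r * ((1 - x*p^(r+1)) * (1 - x*p^(r+2))) := by
  induction r with
  | zero => simp [wF]; ring
  | succ r ih =>
    rw [wF_succ, wF_succ]
    generalize ((1 - p ^ (2*r+1)) * p / ((1 - p ^ (r+1)) ^ 2 * (1 - p ^ (2*r+2)))) = c at *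
    generalize wF p (p^2*x)⁻¹ x r = A at *
    generalize wF p (p^2*x)⁻¹ (p^2*x) r = B at *
    generalize (1 - (p^2*x)⁻¹ * p ^ r) = d at *
    linear_combination (d * c * (1 - p^2*x*p^(r+1))) * ih

lemma wF_tele (p x : K) (hp : p ≠ 0) (hx : x ≠ 0) (L : ℕ)
    (h : ∀ j, 0 < j → j ≤ L → p ^ j ≠ 1 ∧ p ^ (2*j) ≠ 1) :
    ∑ r ∈ Finset.range L, wF p (p^2*x)⁻¹ x r *
      ((1 - p^2*x)^2 * ((1 - x*p^(r+1)) * (1 - x*p^(r+2)))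
        - p * (1-p*x)^2 * ((p^2*x - p^r) * (p*x - p^r))) =
    wF p (p^2*x)⁻¹ x L * ((1 - p^L)^2 * (1-p^(2*L)) * (- (p^2*x*(1-p^3*x^2)) / p^L)) := by
  induction L with
  | zero => simp [wF]
  | succ r ih =>
    rw [Finset.sum_range_succ, ih (fun j h1 h2 => h j h1 (by omega))]
    obtain ⟨h1, h2⟩ := h (r+1) (by omega) le_rfl
    have h1' : 1 - p^(r+1) ≠ 0 := fun hh => h1 (by linear_combination -hh)
    have h2' : 1 - p^(2*r+2) ≠ 0 := fun hh => h2 (by rw [mul_add]; linear_combination -hh)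
    have : wF p (p^2*x)⁻¹ x (r+1) = wF p (p^2*x)⁻¹ x r * _ := Finset.prod_range_succ _ _
    rw [this]
    generalize wF p (p^2*x)⁻¹ x r = A
    have e2 : (1 - (p^2*x)⁻¹ * p ^ r) = (p^2 * x - p^r) / (p^2*x) := by field_simp
    rw [e2, show 2*(r+1) = 2*r+2 by ring]
    have hz : p^r ≠ 0 := pow_ne_zero _ hp
    have e3 : p^(r+1) = p^r*p := pow_succ _ _
    have e4 : p^(r+2) = p^r*p^2 := pow_add _ _ _
    have e5 : p^(2*r+1) = (p^r)^2*p := by ring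
    have e6 : p^(2*r+2) = (p^r)^2*p^2 := by ring
    have e7 : p^(2*r) = (p^r)^2 := by ring
    rw [e3] at h1'
    rw [e6] at h2'
    rw [e3, e4, e5, e6, e7]
    generalize p^r = z at *
    field_simp
    ring

lemma wF_zero_of (p y x : K) (N r : ℕ) (h : y * p ^ N = 1) (hr : N < r) : wF p y x r = 0 := by
  unfold wF
  apply Finset.prod_eq_zero (Finset.mem_range.2 hr)
  rw [h]; simp

lemma wF_rec (p : K) (hp : p ≠ 0) (N L : ℕ) (hL : N + 2 < L)
    (h : ∀ j, 0 < j → j ≤ L → p ^ j ≠ 1 ∧ p ^ (2*j) ≠ 1) :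
    (1 - p^(N+2))^2 * ∑ r ∈ Finset.range L, wF p (p^(N+2))⁻¹ (p^(N+2)) r =
    p * (1 - p^(N+1))^2 * ∑ r ∈ Finset.range L, wF p (p^N)⁻¹ (p^N) r := by
  have hx : p^N ≠ 0 := pow_ne_zero _ hp
  have key := wF_tele p (p^N) hp hx L h
  have e2 : p^(N+2) = p^2 * p^N := by ring
  have e1 : p^(N+1) = p * p^N := by ring
  have hz := wF_zero_of p (p^2 * p^N)⁻¹ (p^N) (N+2) L
    (by rw [e2]; exact inv_mul_cancel₀ (by positivity)) hL
  rw [hz, zero_mul] at key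
  have n1 := (h (N+1) (by omega) (by omega)).1
  have n2 := (h (N+2) (by omega) (by omega)).1
  rw [e1] at n1
  rw [e2] at n2
  have n1' : 1 - p * p^N ≠ 0 := fun hh => n1 (by linear_combination -hh)
  have n2' : 1 - p^2 * p^N ≠ 0 := fun hh => n2 (by linear_combination -hh)
  rw [e1, e2]
  have : (1 - p^2 * p^N) * (1 - p * p^N) * ((1 - p^2 * p^N)^2 * ∑ r ∈ Finset.range L, wF p (p^2 * p^N)⁻¹ (p^2 * p^N) r
     - p * (1 - p * p^N)^2 * ∑ r ∈ Finset.range L, wF p (p^N)⁻¹ (p^N) r) = 0 := by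
    rw [← key, Finset.mul_sum, Finset.mul_sum, ← Finset.sum_sub_distrib, Finset.mul_sum]
    apply Finset.sum_congr rfl
    intro r _
    linear_combination (1 - p^2 * p^N)^2 * wF_shift2 p (p^N) r - p * (1 - p * p^N)^2 * wF_shift1 p (p^N) hp hx r
  have h3 := (mul_eq_zero.1 this).resolve_left (mul_ne_zero n2' n1')
  exact sub_eq_zero.1 h3

lemma wF_sum (p : K) (hp : p ≠ 0) (M L : ℕ) (hL : 2 * M < L)
    (h : ∀ j, 0 < j → j ≤ L → p ^ j ≠ 1 ∧ p ^ (2*j) ≠ 1) :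
    ∑ r ∈ Finset.range L, wF p (p^(2*M))⁻¹ (p^(2*M)) r =
      ∏ j ∈ Finset.range M, (p * (1 - p^(2*j+1))^2 / (1 - p^(2*j+2))^2) := by
  induction M with
  | zero =>
    obtain ⟨l, rfl⟩ : ∃ l, L = l + 1 := ⟨L - 1, by omega⟩
    rw [Finset.sum_range_succ', Finset.sum_eq_zero]
    · simp [wF]
    · intro r _
      exact wF_zero_of p _ _ 0 _ (by simp) (by omega)
  | succ M ih =>
    rw [Finset.prod_range_succ, ← ih (by omega)]
    have := wF_rec p hp (2*M) L (by omega) h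
    have n2 := (h (2*M+2) (by omega) (by omega)).1
    have n2' : 1 - p^(2*M+2) ≠ 0 := fun hh => n2 (by linear_combination -hh)
    rw [show 2*(M+1) = 2*M+2 by ring]
    generalize ∑ r ∈ Finset.range L, wF p (p^(2*M+2))⁻¹ (p^(2*M+2)) r = A at *
    generalize ∑ r ∈ Finset.range L, wF p (p^(2*M))⁻¹ (p^(2*M)) r = B at *
    field_simp
    linear_combination this
end Watson

section Evaluation

/-- `f` is regular at `ζ` with value `v`. -/
def Ev (ζ : ℂ) (f : RatFunc ℚ) (v : ℂ) : Prop :=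
  ∃ a b : ℚ[X], aeval ζ b ≠ 0 ∧ f * algebraMap ℚ[X] (RatFunc ℚ) b = algebraMap ℚ[X] (RatFunc ℚ) a ∧
    aeval ζ a = v * aeval ζ b

variable {ζ : ℂ}

lemma Ev.poly (a : ℚ[X]) : Ev ζ (algebraMap ℚ[X] (RatFunc ℚ) a) (aeval ζ a) :=
  ⟨a, 1, by simp, by simp, by simp⟩

lemma Ev.const (c : ℚ) : Ev ζ (RatFunc.C c) (c : ℂ) := by
  have := Ev.poly (ζ := ζ) (Polynomial.C c)
  simpa using this

lemma Ev.one : Ev ζ 1 1 := by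
  simpa using Ev.poly (ζ := ζ) 1

lemma Ev.zero : Ev ζ 0 0 := by
  simpa using Ev.poly (ζ := ζ) 0

lemma Ev.powX (k : ℕ) : Ev ζ (RatFunc.X ^ k) (ζ ^ k) := by
  simpa using Ev.poly (ζ := ζ) (Polynomial.X ^ k)

lemma Ev.one_sub (k : ℕ) : Ev ζ (1 - RatFunc.X ^ k) (1 - ζ ^ k) := by
  have h := Ev.poly (ζ := ζ) (1 - Polynomial.X ^ k)
  rw [map_sub, map_sub, map_one, map_one, map_pow, map_pow, RatFunc.algebraMap_X, aeval_X] at h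
  exact h

lemma Ev.add {f g : RatFunc ℚ} {v w : ℂ} (hf : Ev ζ f v) (hg : Ev ζ g w) : Ev ζ (f + g) (v + w) := by
  obtain ⟨a, b, h1, h2, h3⟩ := hf
  obtain ⟨c, d, k1, k2, k3⟩ := hg
  refine ⟨a * d + c * b, b * d, by simp [h1, k1], ?_, ?_⟩
  · simp only [map_add, map_mul, ← h2, ← k2]; ring
  · simp only [map_add, map_mul, h3, k3]; ring

lemma Ev.mul {f g : RatFunc ℚ} {v w : ℂ} (hf : Ev ζ f v) (hg : Ev ζ g w) : Ev ζ (f * g) (v * w) := by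
  obtain ⟨a, b, h1, h2, h3⟩ := hf
  obtain ⟨c, d, k1, k2, k3⟩ := hg
  refine ⟨a * c, b * d, by simp [h1, k1], ?_, ?_⟩
  · simp only [map_mul, ← h2, ← k2]; ring
  · simp only [map_mul, h3, k3]; ring

lemma Ev.inv {f : RatFunc ℚ} {v : ℂ} (hf : Ev ζ f v) (hv : v ≠ 0) : Ev ζ f⁻¹ v⁻¹ := by
  obtain ⟨a, b, h1, h2, h3⟩ := hf
  have ha : aeval ζ a ≠ 0 := by rw [h3]; exact mul_ne_zero hv h1
  refine ⟨b, a, ha, ?_, ?_⟩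
  · have hf : f ≠ 0 := by
      rintro rfl
      rw [zero_mul] at h2
      have : a = 0 := RatFunc.algebraMap_injective ℚ (by rw [← h2, map_zero])
      simp [this] at ha
    rw [← h2]; field_simp
  · rw [h3]; field_simp

lemma Ev.div {f g : RatFunc ℚ} {v w : ℂ} (hf : Ev ζ f v) (hg : Ev ζ g w) (hw : w ≠ 0) :
    Ev ζ (f / g) (v / w) := by
  rw [div_eq_mul_inv, div_eq_mul_inv]; exact hf.mul (hg.inv hw)

lemma Ev.pow {f : RatFunc ℚ} {v : ℂ} (hf : Ev ζ f v) (k : ℕ) : Ev ζ (f ^ k) (v ^ k) := by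
  induction k with
  | zero => simpa using Ev.one
  | succ k ih => rw [pow_succ, pow_succ]; exact ih.mul hf

lemma Ev.sum (k : ℕ) (f : ℕ → RatFunc ℚ) (v : ℕ → ℂ) (h : ∀ i < k, Ev ζ (f i) (v i)) :
    Ev ζ (∑ i ∈ Finset.range k, f i) (∑ i ∈ Finset.range k, v i) := by
  induction k with
  | zero => simpa using Ev.zero
  | succ k ih =>
    rw [Finset.sum_range_succ, Finset.sum_range_succ]
    exact (ih fun i hi => h i (by omega)).add (h k (by omega))

lemma Ev.prod (k : ℕ) (f : ℕ → RatFunc ℚ) (v : ℕ → ℂ) (h : ∀ i < k, Ev ζ (f i) (v i)) :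
    Ev ζ (∏ i ∈ Finset.range k, f i) (∏ i ∈ Finset.range k, v i) := by
  induction k with
  | zero => simpa using Ev.one
  | succ k ih =>
    rw [Finset.prod_range_succ, Finset.prod_range_succ]
    exact (ih fun i hi => h i (by omega)).mul (h k (by omega))

lemma Ev.dvd {n : ℕ} (hn : 0 < n) (hζ : IsPrimitiveRoot ζ n) {f : RatFunc ℚ} (h : Ev ζ f 0) :
    Polynomial.cyclotomic n ℚ ∣ f.num := by
  obtain ⟨a, b, h1, h2, h3⟩ := h
  rw [zero_mul] at h3
  have hmin := Polynomial.cyclotomic_eq_minpoly_rat hζ hn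
  have hd : Polynomial.cyclotomic n ℚ ∣ a := by rw [hmin]; exact minpoly.dvd ℚ ζ h3
  have hb : ¬ Polynomial.cyclotomic n ℚ ∣ b := by
    rintro ⟨c, rfl⟩
    apply h1
    rw [map_mul, hmin, minpoly.aeval, zero_mul]
  have hp : Prime (Polynomial.cyclotomic n ℚ) := (Polynomial.cyclotomic.irreducible_rat hn).prime
  have e : f.num * b = a * f.denom := by
    apply RatFunc.algebraMap_injective ℚ
    rw [map_mul, map_mul, ← h2]
    have hden : algebraMap ℚ[X] (RatFunc ℚ) f.denom ≠ 0 := RatFunc.algebraMap_ne_zero f.denom_ne_zero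
    have := RatFunc.num_div_denom f
    rw [div_eq_iff hden] at this
    rw [this]; ring
  have : Polynomial.cyclotomic n ℚ ∣ f.num * b := by rw [e]; exact hd.mul_right _
  exact (hp.dvd_or_dvd this).resolve_right hb

lemma one_sub_X_pow_ne (k : ℕ) (hk : 0 < k) : (1 - RatFunc.X ^ k : RatFunc ℚ) ≠ 0 := by
  intro h
  have h2 : (1 - Polynomial.X ^ k : ℚ[X]) = 0 := RatFunc.algebraMap_injective ℚ (by simpa using h)
  have h3 := congrArg (Polynomial.eval 0) h2
  simp [hk.ne'] at h3

lemma Ev.ratio {t : ℕ} (ht : 0 < t) (hζ : ζ ^ t = 1) (u v : ℕ) (hv : 0 < v) :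
    Ev ζ ((1 - RatFunc.X ^ (t * u)) / (1 - RatFunc.X ^ (t * v))) ((u : ℂ) / v) := by
  have key : ∀ w : ℕ, (1 - RatFunc.X ^ (t * w) : RatFunc ℚ) =
      (1 - RatFunc.X ^ t) * ∑ i ∈ Finset.range w, RatFunc.X ^ (t * i) := by
    intro w
    have := mul_neg_geom_sum (RatFunc.X ^ t : RatFunc ℚ) w
    simp only [← pow_mul] at this
    exact this.symm
  have hs : ∀ w : ℕ, Ev ζ (∑ i ∈ Finset.range w, RatFunc.X ^ (t * i)) (w : ℂ) := by
    intro w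
    have := Ev.sum (ζ := ζ) w (fun i => RatFunc.X ^ (t * i)) (fun i => ζ ^ (t * i))
      (fun i _ => Ev.powX _)
    simpa [pow_mul, hζ] using this
  rw [key u, key v, mul_div_mul_left _ _ (one_sub_X_pow_ne t ht)]
  exact (hs u).div (hs v) (by exact_mod_cast hv.ne')

/-- `(q^s;q^{2s})_k/(q^{2s};q^{2s})_k`. -/
noncomputable def Aq (s k : ℕ) : RatFunc ℚ :=
  ∏ i ∈ Finset.range k, ((1 - RatFunc.X ^ (s * (2 * i + 1))) / (1 - RatFunc.X ^ (s * (2 * i + 2))))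

/-- Its value for small `k`. -/
noncomputable def al (y : ℂ) (k : ℕ) : ℂ :=
  ∏ i ∈ Finset.range k, ((1 - y ^ (2 * i + 1)) / (1 - y ^ (2 * i + 2)))

/-- `(1/2)_a/a!`. -/
noncomputable def ga (a : ℕ) : ℂ :=
  ∏ j ∈ Finset.range a, (((2 * j + 1 : ℕ) : ℂ) / ((2 * j + 2 : ℕ) : ℂ))

lemma Aq_add (s a r : ℕ) : Aq s (a + r) = Aq s a * ∏ i ∈ Finset.range r,
    ((1 - RatFunc.X ^ (s * (2 * (a + i) + 1))) / (1 - RatFunc.X ^ (s * (2 * (a + i) + 2)))) :=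
  Finset.prod_range_add _ _ _

lemma not_dvd_two {n j : ℕ} (hn : n % 2 = 1) (h0 : 0 < j) (h1 : j < n) : ¬ n ∣ 2 * j := by
  intro h
  have hc : Nat.Coprime n 2 := (Nat.coprime_two_right).2 (Nat.odd_iff.2 hn)
  exact absurd (Nat.le_of_dvd h0 (hc.dvd_of_dvd_mul_left h)) (by omega)

lemma Ev.small_block {n s : ℕ} (hn : n % 2 = 1) (hy : IsPrimitiveRoot (ζ ^ s) n) (a r : ℕ) (hr : r < n) :
    Ev ζ (∏ i ∈ Finset.range r, ((1 - RatFunc.X ^ (s * (2 * (a * n + i) + 1))) /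
      (1 - RatFunc.X ^ (s * (2 * (a * n + i) + 2))))) (al (ζ ^ s) r) := by
  apply Ev.prod
  intro i hi
  have e : ∀ c, (ζ ^ s) ^ (2 * i + c) = ζ ^ (s * (2 * (a * n + i) + c)) := by
    intro c
    rw [pow_mul, show 2 * (a * n + i) + c = n * (2 * a) + (2 * i + c) by ring, pow_add _ (n * _),
      pow_mul _ n, hy.pow_eq_one, one_pow, one_mul]
  have hne : 1 - (ζ ^ s) ^ (2 * i + 2) ≠ 0 := by
    rw [sub_ne_zero, ne_comm, Ne, hy.pow_eq_one_iff_dvd, show 2 * i + 2 = 2 * (i + 1) by ring]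
    exact not_dvd_two hn (by omega) (by omega)
  have h2 := Ev.one_sub (ζ := ζ) (s * (2 * (a * n + i) + 2))
  have h1 := Ev.one_sub (ζ := ζ) (s * (2 * (a * n + i) + 1))
  rw [← e] at h1 h2
  exact h1.div h2 hne

lemma Ev.block {n s : ℕ} (hs : 0 < s) (hn : n % 2 = 1) (hy : IsPrimitiveRoot (ζ ^ s) n) (a : ℕ) :
    Ev ζ (∏ i ∈ Finset.range n, ((1 - RatFunc.X ^ (s * (2 * (a * n + i) + 1))) /
      (1 - RatFunc.X ^ (s * (2 * (a * n + i) + 2)))))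
      (((2 * a + 1 : ℕ) : ℂ) / ((2 * a + 2 : ℕ) : ℂ)) := by
  obtain ⟨N, hN⟩ : ∃ N, n = 2 * N + 1 := ⟨n / 2, by omega⟩
  set f : ℕ → RatFunc ℚ := fun i => 1 - RatFunc.X ^ (s * (2 * (a * n + i) + 1)) with hf
  set g : ℕ → RatFunc ℚ := fun i => 1 - RatFunc.X ^ (s * (2 * (a * n + i) + 2)) with hg
  have e : ∀ c b, (ζ ^ s) ^ b = ζ ^ (s * (n * c + b)) := by
    intro c b
    rw [pow_mul, pow_add _ (n * _), pow_mul _ n, hy.pow_eq_one, one_pow, one_mul]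
  have hne : ∀ j, 0 < j → j < n → 1 - (ζ ^ s) ^ j ≠ 0 := by
    intro j h0 h1
    rw [sub_ne_zero, ne_comm]
    exact hy.pow_ne_one_of_pos_of_lt h0.ne' h1
  have split : ∏ i ∈ Finset.range n, (f i / g i) =
      (f N / g (2 * N)) * (∏ i ∈ Finset.range N, (f i / g (N + i))) *
        ∏ i ∈ Finset.range N, (f (N + 1 + i) / g i) := by
    have hF : ∏ i ∈ Finset.range n, f i = (∏ i ∈ Finset.range N, f i) * f N *
        ∏ i ∈ Finset.range N, f (N + 1 + i) := by
      rw [hN, show 2 * N + 1 = (N + 1) + N by ring, Finset.prod_range_add, Finset.prod_range_succ]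
    have hG : ∏ i ∈ Finset.range n, g i = (∏ i ∈ Finset.range N, g i) *
        (∏ i ∈ Finset.range N, g (N + i)) * g (2 * N) := by
      rw [hN, Finset.prod_range_succ, two_mul, Finset.prod_range_add]
    rw [Finset.prod_div_distrib, Finset.prod_div_distrib, Finset.prod_div_distrib, hF, hG]
    rw [div_mul_div_comm, div_mul_div_comm]
    congr 1 <;> ring
  change Ev ζ (∏ i ∈ Finset.range n, (f i / g i)) _
  rw [split]
  have p1 : Ev ζ (f N / g (2 * N)) (((2 * a + 1 : ℕ) : ℂ) / ((2 * a + 2 : ℕ) : ℂ)) := by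
    have := Ev.ratio (ζ := ζ) (t := s * n) (Nat.mul_pos hs (by omega))
      (by rw [pow_mul, hy.pow_eq_one]) (2 * a + 1) (2 * a + 2) (by omega)
    convert this using 2
    · simp only [hf]; congr 2; rw [hN]; ring
    · simp only [hg]; congr 2; rw [hN]; ring
  have p2 : Ev ζ (∏ i ∈ Finset.range N, (f i / g (N + i))) 1 := by
    have := Ev.prod (ζ := ζ) N (fun i => f i / g (N + i)) (fun _ => 1) (by
      intro i hi
      have h1 := Ev.one_sub (ζ := ζ) (s * (n * (2 * a) + (2 * i + 1)))
      have h2 := Ev.one_sub (ζ := ζ) (s * (n * (2 * a + 1) + (2 * i + 1)))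
      rw [← e] at h1 h2
      have h3 := h1.div h2 (hne _ (by omega) (by omega))
      rw [div_self (hne _ (by omega) (by omega))] at h3
      convert h3 using 2
      · simp only [hf]; congr 2; ring
      · simp only [hg]; congr 2; rw [hN]; ring)
    simpa using this
  have p3 : Ev ζ (∏ i ∈ Finset.range N, (f (N + 1 + i) / g i)) 1 := by
    have := Ev.prod (ζ := ζ) N (fun i => f (N + 1 + i) / g i) (fun _ => 1) (by
      intro i hi
      have h1 := Ev.one_sub (ζ := ζ) (s * (n * (2 * a + 1) + (2 * i + 2)))
      have h2 := Ev.one_sub (ζ := ζ) (s * (n * (2 * a) + (2 * i + 2)))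
      rw [← e] at h1 h2
      have h3 := h1.div h2 (hne _ (by omega) (by omega))
      rw [div_self (hne _ (by omega) (by omega))] at h3
      convert h3 using 2
      · simp only [hf]; congr 2; rw [hN]; ring
      · simp only [hg]; congr 2; ring)
    simpa using this
  simpa using (p1.mul p2).mul p3

lemma Ev.Aq_full {n s : ℕ} (hs : 0 < s) (hn : n % 2 = 1) (hy : IsPrimitiveRoot (ζ ^ s) n) (a : ℕ) :
    Ev ζ (Aq s (a * n)) (ga a) := by
  induction a with
  | zero => simpa [Aq, ga] using Ev.one
  | succ a ih =>
    rw [show (a + 1) * n = a * n + n by ring, Aq_add]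
    have : ga (a + 1) = ga a * _ := Finset.prod_range_succ _ _
    rw [this]
    exact ih.mul (Ev.block hs hn hy a)

lemma Ev.Aq {n s : ℕ} (hs : 0 < s) (hn : n % 2 = 1) (hy : IsPrimitiveRoot (ζ ^ s) n) (a r : ℕ)
    (hr : r < n) : Ev ζ (Aq s (a * n + r)) (ga a * al (ζ ^ s) r) := by
  rw [Aq_add]
  exact (Ev.Aq_full hs hn hy a).mul (Ev.small_block hn hy a r hr)

lemma ga_eq (a : ℕ) : ga a = ((ascRat (1/2) a / (a.factorial : ℚ) : ℚ) : ℂ) := by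
  induction a with
  | zero => simp [ga, ascRat]
  | succ a ih =>
    have h1 : ga (a + 1) = ga a * _ := Finset.prod_range_succ _ _
    have h2 : ascRat (1/2) (a + 1) = ascRat (1/2) a * _ := Finset.prod_range_succ _ _
    rw [h1, ih, h2, Nat.factorial_succ]
    have : (a.factorial : ℂ) ≠ 0 := by exact_mod_cast a.factorial_ne_zero
    have h3 : (a : ℂ) + 1 ≠ 0 := by exact_mod_cast a.succ_ne_zero
    push_cast
    rw [show (2 * (a : ℂ) + 2) = 2 * (a + 1) by ring]
    field_simp
    ring

lemma Ev.rhs {M : ℕ} (hζ : IsPrimitiveRoot ζ (4 * M + 1)) :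
    Ev ζ (qint (4 * M + 1) * poch (RatFunc.X ^ 3) (RatFunc.X ^ 4) (2 * M)
      / poch (RatFunc.X ^ 5) (RatFunc.X ^ 4) (2 * M))
      (∏ j ∈ Finset.range M, (ζ^2 * (1 - (ζ^2)^(2*j+1))^2 / (1 - (ζ^2)^(2*j+2))^2)) := by
  set e : ℕ → RatFunc ℚ := fun k => 1 - RatFunc.X ^ k with he
  have e0 : ∀ k, 0 < k → e k ≠ 0 := one_sub_X_pow_ne
  have h3 : poch (RatFunc.X ^ 3) (RatFunc.X ^ 4) (2 * M) =
      (∏ j ∈ Finset.range M, e (4 * (M - 1 - j) + 3)) * ∏ j ∈ Finset.range M, e (4 * (M + j) + 3) := by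
    rw [Finset.prod_range_reflect (fun j => e (4 * j + 3)) M, poch, two_mul, Finset.prod_range_add]
    congr 1 <;> refine Finset.prod_congr rfl fun j _ => ?_ <;> simp only [he] <;> congr 1 <;> ring
  have h5 : poch (RatFunc.X ^ 5) (RatFunc.X ^ 4) (2 * M) * (1 - RatFunc.X) =
      (∏ j ∈ Finset.range M, e (4 * (M - 1 - j) + 1)) * e (4 * M + 1) *
        ∏ j ∈ Finset.range M, e (4 * (M + 1 + j) + 1) := by
    rw [Finset.prod_range_reflect (fun j => e (4 * j + 1)) M,
      ← Finset.prod_range_succ (fun j => e (4 * j + 1)),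
      ← Finset.prod_range_add (fun j => e (4 * j + 1)),
      show M + 1 + M = 2 * M + 1 by ring, Finset.prod_range_succ', poch]
    congr 1
    · refine Finset.prod_congr rfl fun j _ => ?_
      simp only [he]; congr 1; ring
    · simp [he]
  have main : qint (4 * M + 1) * poch (RatFunc.X ^ 3) (RatFunc.X ^ 4) (2 * M)
      / poch (RatFunc.X ^ 5) (RatFunc.X ^ 4) (2 * M) =
      ∏ j ∈ Finset.range M, (e (4 * (M - 1 - j) + 3) * e (4 * (M + j) + 3) /
        (e (4 * (M - 1 - j) + 1) * e (4 * (M + 1 + j) + 1))) := by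
    rw [Finset.prod_div_distrib, Finset.prod_mul_distrib, Finset.prod_mul_distrib, ← h3, qint,
      div_mul_eq_mul_div, div_div, mul_comm (1 - RatFunc.X : RatFunc ℚ), h5]
    have : (1 - RatFunc.X ^ (4 * M + 1) : RatFunc ℚ) = e (4 * M + 1) := rfl
    rw [this, mul_right_comm, mul_comm (e (4 * M + 1)), mul_div_mul_right _ _ (e0 _ (by omega))]
  rw [main]
  apply Ev.prod
  intro j hj
  have hz : ζ ≠ 0 := hζ.ne_zero (by omega)
  have hone := hζ.pow_eq_one
  have hne : ∀ k, 0 < k → k < 4 * M + 1 → 1 - ζ ^ k ≠ 0 := by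
    intro k h0 h1
    rw [sub_ne_zero, ne_comm]
    exact hζ.pow_ne_one_of_pos_of_lt h0.ne' h1
  have r1 : ζ ^ (4 * (M + j) + 3) = ζ ^ (4 * j + 2) := by
    rw [show 4 * (M + j) + 3 = (4 * M + 1) + (4 * j + 2) by ring, pow_add, hone, one_mul]
  have r2 : ζ ^ (4 * (M + 1 + j) + 1) = ζ ^ (4 * j + 4) := by
    rw [show 4 * (M + 1 + j) + 1 = (4 * M + 1) + (4 * j + 4) by ring, pow_add, hone, one_mul]
  have r3 : ζ ^ (4 * (M - 1 - j) + 3) * ζ ^ (4 * j + 2) = 1 := by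
    rw [← pow_add, ← hone]; congr 1; omega
  have r4 : ζ ^ (4 * (M - 1 - j) + 1) * ζ ^ (4 * j + 4) = 1 := by
    rw [← pow_add, ← hone]; congr 1; omega
  have n1 := hne (4 * (M - 1 - j) + 1) (by omega) (by omega)
  have n2 := hne (4 * j + 4) (by omega) (by omega)
  have E := ((Ev.one_sub (ζ := ζ) (4 * (M - 1 - j) + 3)).mul (Ev.one_sub (4 * (M + j) + 3))).div
    ((Ev.one_sub (ζ := ζ) (4 * (M - 1 - j) + 1)).mul (Ev.one_sub (4 * (M + 1 + j) + 1)))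
    (by rw [r2]; exact mul_ne_zero n1 n2)
  convert E using 1
  rw [r1, r2, ← pow_mul, ← pow_mul, show 2 * (2 * j + 1) = 4 * j + 2 by ring,
    show 2 * (2 * j + 2) = 4 * j + 4 by ring]
  rw [div_eq_div_iff (pow_ne_zero _ n2) (mul_ne_zero n1 n2)]
  have hw : ζ ^ (4 * j + 4) = ζ ^ (4 * j + 2) * ζ ^ 2 := by rw [← pow_add]
  have hu : ζ ^ (4 * j + 2) ≠ 0 := pow_ne_zero _ hz
  have hz2 : ζ ^ 2 ≠ 0 := pow_ne_zero _ hz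
  rw [hw] at r4 ⊢
  rw [eq_div_of_mul_eq hu r3, eq_div_of_mul_eq (mul_ne_zero hu hz2) r4]
  field_simp
  ring

lemma al_sum {M : ℕ} (hζ : IsPrimitiveRoot ζ (4 * M + 1)) :
    ∑ r ∈ Finset.range (4 * M + 1), (al (ζ ^ 1) r ^ 2 * al (ζ ^ 2) r * ζ ^ (2 * r)) =
      ∏ j ∈ Finset.range M, (ζ^2 * (1 - (ζ^2)^(2*j+1))^2 / (1 - (ζ^2)^(2*j+2))^2) := by
  rcases Nat.eq_zero_or_pos M with rfl | hM
  · simp [al]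
  have hz : ζ ≠ 0 := hζ.ne_zero (by omega)
  have hone := hζ.pow_eq_one
  have hx : ζ * (ζ ^ 2) ^ (2 * M) = 1 := by rw [← hone]; ring
  have hp : IsPrimitiveRoot (ζ ^ 2) (4 * M + 1) :=
    hζ.pow_of_coprime 2 (Nat.coprime_two_left.2 (Nat.odd_iff.2 (by omega)))
  have hx2 : (ζ ^ 2) ^ (2 * M) * ζ ^ 2 = ζ := by
    linear_combination ζ * hx
  have term : ∀ r, al (ζ ^ 1) r ^ 2 * al (ζ ^ 2) r * ζ ^ (2 * r) =
      wF (ζ ^ 2) ((ζ ^ 2) ^ (2 * M))⁻¹ ((ζ ^ 2) ^ (2 * M)) r := by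
    intro r
    rw [wF, al, al, ← Finset.prod_pow, ← Finset.prod_mul_distrib, pow_mul,
      Finset.pow_eq_prod_const (ζ ^ 2) r, ← Finset.prod_mul_distrib]
    refine Finset.prod_congr rfl fun i _ => ?_
    rw [inv_eq_of_mul_eq_one_left hx, pow_succ' _ i, ← mul_assoc ((ζ ^ 2) ^ (2 * M)), hx2, pow_one]
    rw [show ζ ^ (2 * i + 1) = ζ * (ζ ^ 2) ^ i by ring, show ζ ^ (2 * i + 2) = ζ ^ 2 * (ζ ^ 2) ^ i by ring]
    rw [div_pow, div_mul_div_comm, div_mul_eq_mul_div]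
    rw [mul_div_assoc']
    congr 1; ring
  simp only [term]
  rw [Finset.sum_range_succ, wF_sum (ζ ^ 2) (pow_ne_zero _ hz) M (4 * M) (by omega),
    wF_zero_of (ζ ^ 2) _ _ (2 * M) (4 * M) (inv_mul_cancel₀ (pow_ne_zero _ (pow_ne_zero _ hz)))
      (by omega), add_zero]
  intro j h0 h1
  refine ⟨hp.pow_ne_one_of_pos_of_lt h0.ne' (by omega), ?_⟩
  rw [Ne, hp.pow_eq_one_iff_dvd]
  exact not_dvd_two (by omega) h0 (by omega)

lemma sum_range_blocks {R : Type*} [AddCommMonoid R] (f : ℕ → R) (m n : ℕ) :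
    ∑ k ∈ Finset.range (m * n), f k =
      ∑ a ∈ Finset.range m, ∑ r ∈ Finset.range n, f (a * n + r) := by
  induction m with
  | zero => simp
  | succ m ih => rw [add_mul, one_mul, Finset.sum_range_add, ih, Finset.sum_range_succ]

lemma term_eq (k : ℕ) :
    (poch RatFunc.X (RatFunc.X ^ 2) k) ^ 2 * poch (RatFunc.X ^ 2) (RatFunc.X ^ 4) k
            / ((poch (RatFunc.X ^ 2) (RatFunc.X ^ 2) k) ^ 2
              * poch (RatFunc.X ^ 4) (RatFunc.X ^ 4) k)
            * RatFunc.X ^ (2 * k) = Aq 1 k ^ 2 * Aq 2 k * RatFunc.X ^ (2 * k) := by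
  have h1 : Aq 1 k = poch RatFunc.X (RatFunc.X ^ 2) k / poch (RatFunc.X ^ 2) (RatFunc.X ^ 2) k := by
    rw [Aq, Finset.prod_div_distrib, poch, poch]
    congr 1 <;> refine Finset.prod_congr rfl fun j _ => ?_ <;> congr 1 <;> ring
  have h2 : Aq 2 k = poch (RatFunc.X ^ 2) (RatFunc.X ^ 4) k / poch (RatFunc.X ^ 4) (RatFunc.X ^ 4) k := by
    rw [Aq, Finset.prod_div_distrib, poch, poch]
    congr 1 <;> refine Finset.prod_congr rfl fun j _ => ?_ <;> congr 1 <;> ring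
  rw [h1, h2, div_pow, div_mul_div_comm]

end Evaluation


/-- for positive `m, n` with `n ≡ 1 (mod 4)`, modulo `Φ_n(q)`:
`∑_{k=0}^{mn-1} (q;q²)²_k(q²;q⁴)_k/((q²;q²)²_k(q⁴;q⁴)_k) q^{2k}
 ≡ [n]·(q³;q⁴)_{(n-1)/2}/(q⁵;q⁴)_{(n-1)/2} · ∑_{k=0}^{m-1} (1/2)³_k/k!³`. -/
theorem stmt12 (m n : ℕ) (hm : 0 < m) (hn : 0 < n) (hn4 : n % 4 = 1) :
    (Polynomial.cyclotomic n ℚ) ∣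
      ((∑ k ∈ Finset.range (m * n),
          (poch RatFunc.X (RatFunc.X ^ 2) k) ^ 2 * poch (RatFunc.X ^ 2) (RatFunc.X ^ 4) k
            / ((poch (RatFunc.X ^ 2) (RatFunc.X ^ 2) k) ^ 2
              * poch (RatFunc.X ^ 4) (RatFunc.X ^ 4) k)
            * RatFunc.X ^ (2 * k))
        - qint n * poch (RatFunc.X ^ 3) (RatFunc.X ^ 4) ((n - 1) / 2)
            / poch (RatFunc.X ^ 5) (RatFunc.X ^ 4) ((n - 1) / 2)
            * RatFunc.C (∑ k ∈ Finset.range m,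
                (ascRat (1/2) k) ^ 3 / (k.factorial : ℚ) ^ 3)).num := by
  obtain ⟨M, rfl⟩ : ∃ M, n = 4 * M + 1 := ⟨n / 4, by omega⟩
  have hζ := Complex.isPrimitiveRoot_exp (4 * M + 1) (by omega)
  set ζ := Complex.exp (2 * Real.pi * Complex.I / ((4 * M + 1 : ℕ) : ℂ)) with hdef
  clear_value ζ
  have hp : IsPrimitiveRoot (ζ ^ 2) (4 * M + 1) :=
    hζ.pow_of_coprime 2 (Nat.coprime_two_left.2 (Nat.odd_iff.2 (by omega)))
  have hp1 : IsPrimitiveRoot (ζ ^ 1) (4 * M + 1) := by rwa [pow_one]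
  apply Ev.dvd hn hζ
  rw [show (4 * M + 1 - 1) / 2 = 2 * M by omega]
  simp only [term_eq]
  rw [sum_range_blocks]
  have hR := (Ev.rhs hζ).mul (Ev.const (ζ := ζ) (∑ k ∈ Finset.range m,
                (ascRat (1/2) k) ^ 3 / (k.factorial : ℚ) ^ 3))
  have hL := Ev.sum (ζ := ζ) m (fun a => ∑ r ∈ Finset.range (4 * M + 1),
      (Aq 1 (a * (4 * M + 1) + r) ^ 2 * Aq 2 (a * (4 * M + 1) + r) *
        RatFunc.X ^ (2 * (a * (4 * M + 1) + r))))
    (fun a => ∑ r ∈ Finset.range (4 * M + 1),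
      ((ga a * al (ζ ^ 1) r) ^ 2 * (ga a * al (ζ ^ 2) r) * ζ ^ (2 * (a * (4 * M + 1) + r))))
    (fun a _ => Ev.sum _ _ _ fun r hr =>
      (((Ev.Aq one_pos (by omega) hp1 a r hr).pow 2).mul
        (Ev.Aq two_pos (by omega) hp a r hr)).mul (Ev.powX _))
  have hT := hL.add ((Ev.const (ζ := ζ) (-1)).mul hR)
  convert hT using 1
  · simp only [map_neg, map_one]; ring
  · rw [← al_sum hζ]
    have : ∀ a r : ℕ, (ga a * al (ζ ^ 1) r) ^ 2 * (ga a * al (ζ ^ 2) r) *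
        ζ ^ (2 * (a * (4 * M + 1) + r)) =
        ga a ^ 3 * (al (ζ ^ 1) r ^ 2 * al (ζ ^ 2) r * ζ ^ (2 * r)) := by
      intro a r
      rw [show 2 * (a * (4 * M + 1) + r) = (4 * M + 1) * (2 * a) + 2 * r by ring, pow_add,
        pow_mul _ (4 * M + 1), hζ.pow_eq_one, one_pow]
      ring
    rw [Finset.sum_congr rfl fun a _ => Finset.sum_congr rfl fun r _ => this a r]
    rw [Finset.sum_congr rfl fun a _ => (Finset.mul_sum _ _ _).symm, ← Finset.sum_mul]
    have h3 : ((∑ k ∈ Finset.range m, (ascRat (1/2) k) ^ 3 / (k.factorial : ℚ) ^ 3 : ℚ) : ℂ) =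
        ∑ a ∈ Finset.range m, ga a ^ 3 := by
      rw [Rat.cast_sum]
      refine Finset.sum_congr rfl fun a _ => ?_
      rw [ga_eq, ← div_pow, Rat.cast_pow]
    rw [h3]
    push_cast
    ring
end

section
/- For any prime p ≡ 1 (mod 4) and any positive integer r, ∑_{k=0}^{(p^r-1)/2} (1/2)_k^3 / k!^3 ≡ -Γ_p(1/4)^4 · ∑_{k=0}^{(p^{r-1}-1)/2} (1/2)_k^3 / k!^3 (mod p^{r+1}), as a congruence of p-adic integers. -/
open Finset

/-- The rising factorial `(a)_k` in `ℚ_p`. -/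
noncomputable def asc {p : ℕ} [Fact p.Prime] (a : ℚ_[p]) (k : ℕ) : ℚ_[p] :=
  ∏ i ∈ Finset.range k, (a + i)


open Finset

/-! ## Part 1: forward differences -/

section part1
variable {p : ℕ} [Fact p.Prime]

lemma sq_fd_mul (n : ℕ) : ∀ (f g : ℤ_[p] → ℤ_[p]) (α β : ℕ → ℕ) (c : ℕ),
    (∀ m ≤ n, ∀ x, (p : ℤ_[p]) ^ α m ∣ (fwdDiff 1)^[m] f x) →
    (∀ m ≤ n, ∀ x, (p : ℤ_[p]) ^ β m ∣ (fwdDiff 1)^[m] g x) →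
    (∀ i j, i + j = n → c ≤ α i + β j) →
    ∀ x, (p : ℤ_[p]) ^ c ∣ (fwdDiff 1)^[n] (fun y => f y * g y) x := by
  induction n with
  | zero =>
    intro f g α β c hf hg h x
    have h1 := hf 0 le_rfl x
    have h2 := hg 0 le_rfl x
    simp only [Function.iterate_zero, id] at h1 h2 ⊢
    exact (pow_dvd_pow _ (h 0 0 rfl)).trans (by rw [pow_add]; exact mul_dvd_mul h1 h2)
  | succ n ih =>
    intro f g α β c hf hg h x
    have key : fwdDiff 1 (fun y => f y * g y) =
        (fun y => fwdDiff 1 f y * g (y + 1)) + (fun y => f y * fwdDiff 1 g y) := by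
      funext y
      simp only [fwdDiff, Pi.add_apply]
      ring
    rw [Function.iterate_succ_apply, key, fwdDiff_iter_add]
    refine dvd_add ?_ ?_
    · refine ih (fwdDiff 1 f) (fun y => g (y + 1)) (fun m => α (m + 1)) β c ?_ ?_ ?_ x
      · intro m hm x
        rw [← Function.iterate_succ_apply]
        exact hf (m + 1) (by omega) x
      · intro m hm x
        rw [fwdDiff_iter_comp_add]
        exact hg m (by omega) _
      · intro i j hij
        exact h (i + 1) j (by omega)
    · refine ih f (fwdDiff 1 g) α (fun m => β (m + 1)) c ?_ ?_ ?_ x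
      · intro m hm x
        exact hf m (by omega) x
      · intro m hm x
        rw [← Function.iterate_succ_apply]
        exact hg (m + 1) (by omega) x
      · intro i j hij
        exact h i (j + 1) (by omega)

/-- The class of functions with strongly divisible differences. -/
def SqCls (f : ℤ_[p] → ℤ_[p]) : Prop :=
  Continuous f ∧ ∀ n x, (p : ℤ_[p]) ^ (n - n / 5) ∣ (fwdDiff 1)^[n] f x

/-- The strict class. -/
def SqStr (f : ℤ_[p] → ℤ_[p]) : Prop :=
  Continuous f ∧ ∀ n x, (p : ℤ_[p]) ^ n ∣ (fwdDiff 1)^[n] f x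

lemma SqStr.cls {f : ℤ_[p] → ℤ_[p]} (h : SqStr f) : SqCls f :=
  ⟨h.1, fun n x => (pow_dvd_pow _ (Nat.sub_le _ _)).trans (h.2 n x)⟩

lemma fd_const (c : ℤ_[p]) (n : ℕ) (x : ℤ_[p]) :
    (fwdDiff 1)^[n + 1] (fun _ : ℤ_[p] => c) x = 0 := by
  induction n with
  | zero => simp [fwdDiff]
  | succ n ih =>
    rw [Function.iterate_succ_apply]
    have : fwdDiff 1 (fun _ : ℤ_[p] => c) = (0 : ℤ_[p]) • (fun _ : ℤ_[p] => c) := by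
      funext y; simp [fwdDiff]
    rw [this, fwdDiff_iter_const_smul]
    simp

lemma SqStr.const (c : ℤ_[p]) : SqStr (fun _ : ℤ_[p] => c) := by
  refine ⟨continuous_const, ?_⟩
  rintro (_ | n) x
  · simp
  · rw [fd_const]; exact dvd_zero _

lemma SqStr.pX : SqStr (fun x : ℤ_[p] => (p : ℤ_[p]) * x) := by
  refine ⟨by fun_prop, ?_⟩
  rintro (_ | _ | n) x
  · simp
  · simp [fwdDiff, mul_add]
  · rw [Function.iterate_succ_apply]
    have : fwdDiff 1 (fun x : ℤ_[p] => (p : ℤ_[p]) * x) = fun _ => (p : ℤ_[p]) := by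
      funext y; simp [fwdDiff, mul_add]
    rw [this, fd_const]; exact dvd_zero _

lemma SqStr.add {f g : ℤ_[p] → ℤ_[p]} (hf : SqStr f) (hg : SqStr g) :
    SqStr (fun x => f x + g x) := by
  refine ⟨hf.1.add hg.1, fun n x => ?_⟩
  have := fwdDiff_iter_add (1 : ℤ_[p]) f g n
  change _ ∣ (fwdDiff 1)^[n] (f + g) x
  rw [this]
  exact dvd_add (hf.2 n x) (hg.2 n x)

lemma SqStr.mul {f g : ℤ_[p] → ℤ_[p]} (hf : SqStr f) (hg : SqStr g) :
    SqStr (fun x => f x * g x) := by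
  refine ⟨hf.1.mul hg.1, fun n x => ?_⟩
  exact sq_fd_mul n f g id id n (fun m _ => hf.2 m) (fun m _ => hg.2 m) (by intro i j h; simp [h]) x

lemma SqCls.add {f g : ℤ_[p] → ℤ_[p]} (hf : SqCls f) (hg : SqCls g) :
    SqCls (fun x => f x + g x) := by
  refine ⟨hf.1.add hg.1, fun n x => ?_⟩
  have := fwdDiff_iter_add (1 : ℤ_[p]) f g n
  change _ ∣ (fwdDiff 1)^[n] (f + g) x
  rw [this]
  exact dvd_add (hf.2 n x) (hg.2 n x)

lemma SqCls.mul {f g : ℤ_[p] → ℤ_[p]} (hf : SqCls f) (hg : SqCls g) :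
    SqCls (fun x => f x * g x) := by
  refine ⟨hf.1.mul hg.1, fun n x => ?_⟩
  exact sq_fd_mul n f g _ _ _ (fun m _ => hf.2 m) (fun m _ => hg.2 m)
    (by intro i j h; omega) x

lemma SqCls.const (c : ℤ_[p]) : SqCls (fun _ : ℤ_[p] => c) := (SqStr.const c).cls

lemma SqCls.pow {f : ℤ_[p] → ℤ_[p]} (hf : SqCls f) (k : ℕ) : SqCls (fun x => f x ^ k) := by
  induction k with
  | zero => simpa using SqCls.const (1 : ℤ_[p])
  | succ k ih => simpa [pow_succ] using ih.mul hf

lemma SqCls.sum {ι : Type*} (s : Finset ι) (f : ι → ℤ_[p] → ℤ_[p]) (hf : ∀ i ∈ s, SqCls (f i)) :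
    SqCls (fun x => ∑ i ∈ s, f i x) := by
  classical
  induction s using Finset.induction_on with
  | empty => simpa using SqCls.const (0 : ℤ_[p])
  | insert a s ha ih =>
    simp only [Finset.sum_insert ha]
    exact (hf a (by simp)).add (ih fun i hi => hf i (by simp [hi]))

lemma SqCls.shift {f : ℤ_[p] → ℤ_[p]} (hf : SqCls f) (c : ℤ_[p]) : SqCls (fun x => f (x + c)) := by
  refine ⟨hf.1.comp (by fun_prop), fun n x => ?_⟩
  rw [fwdDiff_iter_comp_add]
  exact hf.2 n _

lemma SqCls.neg_arg {f : ℤ_[p] → ℤ_[p]} (hf : SqCls f) : SqCls (fun x => f (-x)) := by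
  refine ⟨hf.1.comp (by fun_prop), fun n x => ?_⟩
  have : ∀ n x, (fwdDiff 1)^[n] (fun x => f (-x)) x = (-1) ^ n * (fwdDiff 1)^[n] f (-x - n) := by
    intro n
    induction n with
    | zero => simp
    | succ n ih =>
      intro x
      rw [Function.iterate_succ_apply', Function.iterate_succ_apply']
      simp only [fwdDiff, ih]
      have e1 : -(x + 1) - (n : ℤ_[p]) = -x - ((n + 1 : ℕ) : ℤ_[p]) := by push_cast; ring
      have e2 : -x - ((n + 1 : ℕ) : ℤ_[p]) + 1 = -x - (n : ℤ_[p]) := by push_cast; ring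
      rw [e1, e2]
      ring
  rw [this]
  exact (hf.2 n _).mul_left _

/-- polynomials in `p y` are in the strict class -/
lemma SqStr.poly (P : Polynomial ℤ_[p]) : SqStr (fun y => P.eval ((p : ℤ_[p]) * y)) := by
  induction P using Polynomial.induction_on' with
  | add P Q hP hQ => simpa using hP.add hQ
  | monomial n a =>
    simp only [Polynomial.eval_monomial]
    refine (SqStr.const a).mul ?_
    induction n with
    | zero => simpa using SqStr.const (1 : ℤ_[p])
    | succ n ih => simpa only [pow_succ] using ih.mul SqStr.pX

/-- functions satisfying a first-order difference equation -/
lemma SqCls.of_rec {K : ℤ_[p] → ℤ_[p]} (hK : Continuous K) (A B : Polynomial ℤ_[p])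
    (h : ∀ y, K (y + 1) = (1 + p * A.eval ((p : ℤ_[p]) * y)
      + ((p : ℤ_[p]) * y) ^ 4 * B.eval ((p : ℤ_[p]) * y)) * K y) : SqCls K := by
  refine ⟨hK, ?_⟩
  set σ : ℤ_[p] → ℤ_[p] := fun y => p * A.eval ((p : ℤ_[p]) * y)
      + ((p : ℤ_[p]) * y) ^ 4 * B.eval ((p : ℤ_[p]) * y) with hσ
  have hd : fwdDiff 1 K = fun y => σ y * K y := by
    funext y
    simp only [fwdDiff, h, hσ]
    ring
  -- divisibility for σ
  have hs : ∀ k x, (p : ℤ_[p]) ^ (if k < 4 then k + 1 else k) ∣ (fwdDiff 1)^[k] σ x := by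
    intro k x
    have e : σ = ((p : ℤ_[p]) • fun y => A.eval ((p : ℤ_[p]) * y)) +
        (fun y => (Polynomial.X ^ 4 * B).eval ((p : ℤ_[p]) * y)) := by
      funext y
      simp [hσ]
    have e2 : (fun y => (Polynomial.X ^ 4 * B).eval ((p : ℤ_[p]) * y)) =
        ((p : ℤ_[p]) ^ 4 • fun y => y ^ 4 * B.eval ((p : ℤ_[p]) * y)) := by
      funext y
      simp
      ring
    rw [e, fwdDiff_iter_add]
    refine dvd_add ?_ ?_
    · rw [fwdDiff_iter_const_smul, Pi.smul_apply, smul_eq_mul]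
      refine (pow_dvd_pow _ (show _ ≤ k + 1 by split_ifs <;> omega)).trans ?_
      rw [pow_succ']
      exact mul_dvd_mul_left _ ((SqStr.poly A).2 k x)
    · split_ifs with hk
      · rw [e2, fwdDiff_iter_const_smul, Pi.smul_apply, smul_eq_mul]
        exact (pow_dvd_pow _ (by omega)).trans (dvd_mul_right _ _)
      · exact (SqStr.poly _).2 k x
  intro n
  induction n using Nat.strong_induction_on with
  | _ n ih =>
    rcases n with _ | n
    · intro x; simp
    · intro x
      rw [Function.iterate_succ_apply, hd]
      refine sq_fd_mul n σ K _ _ _ (fun m _ => hs m) (fun m hm => ih m (by omega)) ?_ x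
      intro i j hij
      split_ifs <;> omega

end part1

open Finset

/-! ## Part 2: even functions in the class -/

section part2
variable {p : ℕ} [hp : Fact p.Prime]

lemma natCast_dvd_p_pow {n e : ℕ} (hn : n ≠ 0) (he : padicValNat p n ≤ e) :
    (n : ℤ_[p]) ∣ (p : ℤ_[p]) ^ e := by
  obtain ⟨m, hm⟩ : p ^ padicValNat p n ∣ n := pow_padicValNat_dvd
  have hm' : ¬ p ∣ m := by
    rintro ⟨m', rfl⟩
    have : p ^ (padicValNat p n + 1) ∣ n := ⟨m', by rw [pow_succ, mul_assoc]; exact hm⟩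
    exact pow_succ_padicValNat_not_dvd hn this
  have hu : IsUnit (m : ℤ_[p]) := by
    rw [PadicInt.isUnit_iff, PadicInt.norm_natCast_eq_one_iff]
    exact (Nat.Prime.coprime_iff_not_dvd hp.out).2 hm'
  have : (n : ℤ_[p]) = p ^ padicValNat p n * m := by
    conv_lhs => rw [hm]
    push_cast; rfl
  rw [this, hu.mul_right_dvd]
  exact pow_dvd_pow _ he

lemma four_val_factorial (h5 : 5 ≤ p) {k : ℕ} (hk : k ≠ 0) :
    4 * padicValNat p k.factorial < k := by
  have := sub_one_mul_padicValNat_factorial_lt_of_ne_zero p hk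
  have h2 : 4 * padicValNat p k.factorial ≤ (p - 1) * padicValNat p k.factorial :=
    Nat.mul_le_mul_right _ (by omega)
  omega

lemma fact_dvd (h5 : 5 ≤ p) {k : ℕ} :
    ((k.factorial : ℕ) : ℤ_[p]) * (p : ℤ_[p]) ^ (if 2 ≤ k then k / 2 + 1 else 0) ∣
      (p : ℤ_[p]) ^ (k - k / 5) := by
  split_ifs with hk
  · have h1 := four_val_factorial h5 (show k ≠ 0 by omega)
    have h2 : k - k / 5 = (k - k / 5 - (k / 2 + 1)) + (k / 2 + 1) := by omega
    rw [h2, pow_add _ (k - k / 5 - (k / 2 + 1))]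
    refine mul_dvd_mul_right (natCast_dvd_p_pow (p := p) (Nat.factorial_ne_zero k) ?_) _
    omega
  · have : k = 0 ∨ k = 1 := by omega
    rcases this with rfl | rfl <;> simp

lemma cls_poly (h5 : 5 ≤ p) {f : ℤ_[p] → ℤ_[p]} (hf : SqCls f) (s : ℕ) :
    ∃ P : Polynomial ℤ_[p], (∀ j, 2 ≤ j → (p : ℤ_[p]) ^ (j / 2 + 1) ∣ P.coeff j) ∧
      ∀ w, (p : ℤ_[p]) ^ s ∣ f w - P.eval w := by
  have hτ : ∀ k, ∃ τ : ℤ_[p], (fwdDiff 1)^[k] f 0 =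
      ((k.factorial : ℕ) : ℤ_[p]) * (p : ℤ_[p]) ^ (if 2 ≤ k then k / 2 + 1 else 0) * τ :=
    fun k => (fact_dvd h5).trans (hf.2 k 0)
  choose τ hτ using hτ
  let P : Polynomial ℤ_[p] := ∑ k ∈ range (2 * s),
    Polynomial.C ((p : ℤ_[p]) ^ (if 2 ≤ k then k / 2 + 1 else 0) * τ k) * descPochhammer ℤ_[p] k
  refine ⟨P, ?_, ?_⟩
  · intro j hj
    simp only [P, Polynomial.finsetSum_coeff, Polynomial.coeff_C_mul]
    refine Finset.dvd_sum fun k _ => ?_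
    by_cases hkj : k < j
    · rw [Polynomial.coeff_eq_zero_of_natDegree_lt (by rw [descPochhammer_natDegree]; exact hkj)]
      simp
    · rw [if_pos (by omega)]
      refine dvd_mul_of_dvd_left (dvd_mul_of_dvd_left (pow_dvd_pow _ ?_) _) _
      have : j / 2 ≤ k / 2 := Nat.div_le_div_right (by omega)
      omega
  · have hcl : IsClosed {w : ℤ_[p] | (p : ℤ_[p]) ^ s ∣ f w - P.eval w} := by
      have : {w : ℤ_[p] | (p : ℤ_[p]) ^ s ∣ f w - P.eval w} =
          {w | ‖f w - P.eval w‖ ≤ (p : ℝ) ^ (-s : ℤ)} := by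
        ext w
        simp only [Set.mem_ofPred_eq]
        rw [PadicInt.norm_le_pow_iff_mem_span_pow, Ideal.mem_span_singleton]
      rw [this]
      exact isClosed_le ((hf.1.sub P.continuous).norm) continuous_const
    intro w
    refine DenseRange.induction_on (p := fun w => (p : ℤ_[p]) ^ s ∣ f w - P.eval w)
      PadicInt.denseRange_natCast w hcl fun n => ?_
    have h1 := shift_eq_sum_fwdDiff_iter (1 : ℤ_[p]) f n 0
    simp only [zero_add, nsmul_eq_mul, mul_one] at h1
    have hP : P.eval (n : ℤ_[p]) = ∑ k ∈ range (2 * s), (n.choose k : ℤ_[p]) * (fwdDiff 1)^[k] f 0 := by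
      simp only [P, Polynomial.eval_finsetSum, Polynomial.eval_mul, Polynomial.eval_C]
      refine sum_congr rfl fun k _ => ?_
      rw [descPochhammer_eval_eq_descFactorial, hτ, Nat.descFactorial_eq_factorial_mul_choose]
      push_cast
      ring
    have h2 : f n = ∑ k ∈ range (max (n + 1) (2 * s)), (n.choose k : ℤ_[p]) * (fwdDiff 1)^[k] f 0 := by
      rw [h1]
      refine sum_subset (range_mono (le_max_left _ _)) ?_
      intro k _ hk
      rw [mem_range, not_lt] at hk
      rw [Nat.choose_eq_zero_of_lt (by omega)]; simp
    have h3 : f n - P.eval (n : ℤ_[p]) = ∑ k ∈ range (max (n + 1) (2 * s)) \ range (2 * s),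
        (n.choose k : ℤ_[p]) * (fwdDiff 1)^[k] f 0 := by
      rw [h2, hP, ← sum_sdiff (range_mono (le_max_right (n + 1) (2 * s)))]
      ring
    rw [h3]
    refine Finset.dvd_sum fun k hk => ?_
    simp only [mem_sdiff, mem_range, not_lt] at hk
    exact dvd_mul_of_dvd_right ((pow_dvd_pow _ (by omega)).trans (hf.2 k 0)) _

lemma two_unit (h5 : 5 ≤ p) : IsUnit (2 : ℤ_[p]) := by
  have : ((2 : ℕ) : ℤ_[p]) = 2 := by norm_num
  rw [← this, PadicInt.isUnit_iff, PadicInt.norm_natCast_eq_one_iff]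
  refine (Nat.Prime.coprime_iff_not_dvd hp.out).2 ?_
  intro h
  have := Nat.le_of_dvd (by norm_num) h
  omega

lemma poly_even_part (P : Polynomial ℤ_[p]) (w : ℤ_[p]) (n : ℕ) (hn : P.natDegree < 2 * n) :
    P.eval w + P.eval (-w) = 2 * ∑ i ∈ range n, P.coeff (2 * i) * w ^ (2 * i) := by
  have aux : ∀ (n : ℕ) (c : ℕ → ℤ_[p]), ∑ i ∈ range (2 * n), c i * w ^ i +
      ∑ i ∈ range (2 * n), c i * (-w) ^ i = 2 * ∑ i ∈ range n, c (2 * i) * w ^ (2 * i) := by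
    intro n c
    induction n with
    | zero => simp
    | succ n ih =>
      rw [show 2 * (n + 1) = 2 * n + 1 + 1 by ring]
      simp only [sum_range_succ]
      have e1 : (-w) ^ (2 * n) = w ^ (2 * n) := by rw [pow_mul, neg_sq, ← pow_mul]
      have e2 : (-w) ^ (2 * n + 1) = - w ^ (2 * n + 1) := by rw [pow_succ, e1]; ring
      rw [e1, e2, mul_add, ← ih]
      ring
  rw [Polynomial.eval_eq_sum_range' hn, Polynomial.eval_eq_sum_range' hn, aux]

lemma cls_even (h5 : 5 ≤ p) {f : ℤ_[p] → ℤ_[p]} (hf : SqCls f) (hev : ∀ w, f (-w) = f w) (s : ℕ) :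
    ∃ (n : ℕ) (c0 : ℤ_[p]) (c : ℕ → ℤ_[p]), ∀ w, (p : ℤ_[p]) ^ s ∣
      f w - (c0 + ∑ i ∈ range n, (p : ℤ_[p]) ^ (i + 2) * c i * w ^ (2 * (i + 1))) := by
  obtain ⟨P, hP, hPf⟩ := cls_poly h5 hf s
  have hc : ∀ i, ∃ c : ℤ_[p], P.coeff (2 * (i + 1)) = (p : ℤ_[p]) ^ (i + 2) * c := fun i => by
    have := hP (2 * (i + 1)) (by omega)
    rwa [show 2 * (i + 1) / 2 + 1 = i + 2 by omega] at this
  choose c hc using hc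
  refine ⟨P.natDegree, P.coeff 0, c, fun w => ?_⟩
  have h1 := hPf w
  have h2 := hPf (-w)
  rw [hev] at h2
  have h3 := dvd_add h1 h2
  have h4 : f w - P.eval w + (f w - P.eval (-w)) = 2 * (f w - (P.coeff 0 +
      ∑ i ∈ range P.natDegree, (p : ℤ_[p]) ^ (i + 2) * c i * w ^ (2 * (i + 1)))) := by
    have := poly_even_part P w (P.natDegree + 1) (by omega)
    rw [sum_range_succ'] at this
    simp only [hc] at this
    simp only [mul_zero, pow_zero, mul_one] at this
    linear_combination -this
  rw [h4, (two_unit h5).dvd_mul_left] at h3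
  exact h3

end part2

open Finset

/-! ## Part 3: reduction modulo exact terms -/

section part3
variable {p : ℕ} [hp : Fact p.Prime]

/-- The telescoping operator. -/
noncomputable def sqT (q : ℤ_[p]) (ψ : ℤ_[p] → ℤ_[p]) (a : ℤ_[p]) : ℤ_[p] :=
  (a + 2 * q) ^ 3 * ψ (a + 1) - a ^ 3 * ψ a

lemma sqT_phi (q : ℤ_[p]) (hq : 4 * q = 1) (d : ℕ) : ∃ e : ℕ → ℤ_[p], ∀ a,
    2 * sqT q (fun a => (a - q) ^ (2 * d)) a =
      (4 * d + 3) * (a + q) ^ (2 * (d + 1)) + ∑ j ∈ range (d + 1), e j * (a + q) ^ (2 * j) := by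
  let P : Polynomial ℤ_[p] := (Polynomial.X + Polynomial.C q) ^ 3 *
    (Polynomial.X + Polynomial.C (2 * q)) ^ (2 * d)
  have m1 : ((Polynomial.X + Polynomial.C q : Polynomial ℤ_[p]) ^ 3).Monic :=
    (Polynomial.monic_X_add_C q).pow 3
  have m2 : ((Polynomial.X + Polynomial.C (2 * q) : Polynomial ℤ_[p]) ^ (2 * d)).Monic :=
    (Polynomial.monic_X_add_C _).pow _
  have hdeg : P.natDegree = 2 * d + 3 := by
    simp only [P]
    rw [m1.natDegree_mul m2, (Polynomial.monic_X_add_C q).natDegree_pow,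
      (Polynomial.monic_X_add_C (2 * q)).natDegree_pow, Polynomial.natDegree_X_add_C,
      Polynomial.natDegree_X_add_C]
    ring
  have hc : P.coeff (2 * (d + 1)) = q * (4 * d + 3) := by
    have h1 : P.nextCoeff = P.coeff (2 * (d + 1)) := by
      rw [Polynomial.nextCoeff_of_natDegree_pos (by omega), hdeg]
      rfl
    rw [← h1]
    simp only [P]
    rw [m1.nextCoeff_mul m2, (Polynomial.monic_X_add_C q).nextCoeff_pow,
      (Polynomial.monic_X_add_C (2 * q)).nextCoeff_pow, Polynomial.nextCoeff_X_add_C,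
      Polynomial.nextCoeff_X_add_C]
    simp only [nsmul_eq_mul]
    push_cast
    ring
  refine ⟨fun j => 4 * P.coeff (2 * j), fun a => ?_⟩
  have h := poly_even_part P (a + q) (d + 2) (by omega)
  rw [sum_range_succ, hc] at h
  have hE : P.eval (a + q) + P.eval (-(a + q)) = sqT q (fun a => (a - q) ^ (2 * d)) a := by
    simp only [P, sqT, Polynomial.eval_mul, Polynomial.eval_pow, Polynomial.eval_add,
      Polynomial.eval_X, Polynomial.eval_C]
    have e1 : a + q + 2 * q = a + 1 - q := by linear_combination hq
    have e2 : (-(a + q) + 2 * q) ^ (2 * d) = (a - q) ^ (2 * d) := by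
      rw [show -(a + q) + 2 * q = -(a - q) by ring, pow_mul, neg_sq, ← pow_mul]
    rw [e1, e2]
    ring
  rw [← hE, h]
  simp only [mul_assoc, ← mul_sum]
  linear_combination (4 * d + 3) * (a + q) ^ (2 * (d + 1)) * hq

lemma sqT_lin (q c c' : ℤ_[p]) (ψ ψ' : ℤ_[p] → ℤ_[p]) (a : ℤ_[p]) :
    sqT q (fun a => c * ψ a + c' * ψ' a) a = c * sqT q ψ a + c' * sqT q ψ' a := by
  simp only [sqT]; ring

lemma sqT_sum (q : ℤ_[p]) (n : ℕ) (c : ℕ → ℤ_[p]) (ψ : ℕ → ℤ_[p] → ℤ_[p]) (a : ℤ_[p]) :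
    sqT q (fun a => ∑ i ∈ range n, c i * ψ i a) a = ∑ i ∈ range n, c i * sqT q (ψ i) a := by
  simp only [sqT, mul_sum, ← sum_sub_distrib]
  refine sum_congr rfl fun i _ => by ring

lemma sqT_reduce (q : ℤ_[p]) (hq : 4 * q = 1) (d : ℕ) : ∀ e : ℕ → ℤ_[p],
    ∃ (μ : ℤ_[p]) (ψ : ℤ_[p] → ℤ_[p]), ∀ a,
      ((∏ j ∈ range d, (4 * j + 3) : ℕ) : ℤ_[p]) * ∑ j ∈ range (d + 1), e j * (a + q) ^ (2 * j) =
        μ + sqT q ψ a := by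
  induction d with
  | zero =>
    intro e
    exact ⟨e 0, fun _ => 0, fun a => by simp [sqT]⟩
  | succ d ih =>
    intro e
    obtain ⟨e', he'⟩ := sqT_phi q hq d
    obtain ⟨μ, ψ, h⟩ := ih (fun j => (4 * d + 3) * e j - e (d + 1) * e' j)
    refine ⟨μ, fun a => 1 * ψ a + 2 * ((∏ j ∈ range d, (4 * j + 3) : ℕ) : ℤ_[p]) * e (d + 1) *
      ((fun a => (a - q) ^ (2 * d)) a), fun a => ?_⟩
    rw [sqT_lin, prod_range_succ, sum_range_succ _ (d + 1)]
    have h1 := h a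
    have h2 := he' a
    simp only [sub_mul, sum_sub_distrib, mul_assoc, ← mul_sum] at h1
    simp only [mul_assoc] at h2 ⊢
    push_cast at h1 h2 ⊢
    linear_combination h1 - (∏ j ∈ range d, (4 * (j : ℤ_[p]) + 3)) * e (d + 1) * h2

lemma prod_dvd_factorial (d : ℕ) : (∏ j ∈ range (d + 1), (4 * j + 3)) ∣ (4 * d + 3).factorial := by
  induction d with
  | zero => simp; decide
  | succ d ih =>
    rw [prod_range_succ, show 4 * (d + 1) + 3 = (4 * d + 6) + 1 by ring, Nat.factorial_succ, mul_comm]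
    exact mul_dvd_mul_left _ (ih.trans (Nat.factorial_dvd_factorial (by omega)))

lemma prod_dvd_p_pow (h5 : 5 ≤ p) (d : ℕ) :
    ((∏ j ∈ range (d + 1), (4 * j + 3) : ℕ) : ℤ_[p]) ∣ (p : ℤ_[p]) ^ d := by
  have h1 := prod_dvd_factorial d
  refine (Nat.cast_dvd_cast h1).trans (natCast_dvd_p_pow (p := p) (Nat.factorial_ne_zero _) ?_)
  have := four_val_factorial h5 (k := 4 * d + 3) (by omega)
  omega

lemma even_reduce (h5 : 5 ≤ p) (q : ℤ_[p]) (hq : 4 * q = 1) {f : ℤ_[p] → ℤ_[p]} (hf : SqCls f)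
    (hev : ∀ w, f (-w) = f w) (s : ℕ) : ∃ (μ : ℤ_[p]) (ψ : ℤ_[p] → ℤ_[p]), ∀ a,
      (p : ℤ_[p]) ^ s ∣ f (a + q) - (μ + (p : ℤ_[p]) ^ 2 * sqT q ψ a) := by
  obtain ⟨n, c0, c, hc⟩ := cls_even h5 hf hev s
  choose τ hτ using prod_dvd_p_pow (p := p) h5
  choose μ ψ hψ using fun i => sqT_reduce q hq (i + 1) (fun j => if j = i + 1 then 1 else 0)
  refine ⟨c0 + ∑ i ∈ range n, (p : ℤ_[p]) ^ 2 * (τ i * c i) * μ i,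
    fun a => ∑ i ∈ range n, (τ i * c i) * ψ i a, fun a => ?_⟩
  rw [sqT_sum]
  convert hc (a + q) using 2
  rw [add_assoc, mul_sum, ← sum_add_distrib]
  congr 1
  refine sum_congr rfl fun i _ => ?_
  have h := hψ i a
  have h' : ∑ j ∈ range (i + 1 + 1), (if j = i + 1 then (1 : ℤ_[p]) else 0) * (a + q) ^ (2 * j) =
      (a + q) ^ (2 * (i + 1)) := by
    simp [ite_mul]
  rw [h'] at h
  rw [pow_add, hτ i]
  linear_combination -(p : ℤ_[p]) ^ 2 * (τ i * c i) * h

lemma even_near_zero (h5 : 5 ≤ p) {f : ℤ_[p] → ℤ_[p]} (hf : SqCls f)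
    (hev : ∀ w, f (-w) = f w) (n : ℕ) (t : ℤ_[p]) :
    (p : ℤ_[p]) ^ (2 * n + 2) ∣ f ((p : ℤ_[p]) ^ n * t) - f 0 := by
  obtain ⟨m, c0, c, hc⟩ := cls_even h5 hf hev (2 * n + 2)
  have h1 := hc ((p : ℤ_[p]) ^ n * t)
  have h2 := hc 0
  simp only [ne_eq, Nat.mul_eq_zero, OfNat.ofNat_ne_zero, Nat.add_eq_zero_iff, one_ne_zero, and_false, or_self,
    not_false_eq_true, zero_pow, mul_zero, sum_const_zero, add_zero] at h2
  have h3 : (p : ℤ_[p]) ^ (2 * n + 2) ∣ ∑ i ∈ range m, (p : ℤ_[p]) ^ (i + 2) * c i *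
      ((p : ℤ_[p]) ^ n * t) ^ (2 * (i + 1)) := by
    refine Finset.dvd_sum fun i _ => ?_
    refine ⟨(p : ℤ_[p]) ^ i * c i * t ^ 2 * ((p : ℤ_[p]) ^ n * t) ^ (2 * i), ?_⟩
    ring
  have h4 := dvd_add (dvd_sub h1 h2) h3
  convert h4 using 1
  ring

end part3

open Finset

/-! ## Part 4: the p-adic Gamma function -/

section part4
variable {p : ℕ} [hp : Fact p.Prime]

open Classical in
/-- unit part of `x`, with `1` in place of non-units -/
noncomputable def sqs (x : ℤ_[p]) : ℤ_[p] := if (p : ℤ_[p]) ∣ x then 1 else x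

lemma natCast_p_dvd (n : ℕ) : (p : ℤ_[p]) ∣ (n : ℤ_[p]) ↔ p ∣ n := by
  rw [← PadicInt.norm_lt_one_iff_dvd, PadicInt.norm_natCast_lt_one_iff]

lemma sqs_norm (x : ℤ_[p]) : ‖sqs x‖ = 1 := by
  unfold sqs
  split_ifs with h
  · simp
  · rw [← PadicInt.norm_lt_one_iff_dvd] at h
    exact le_antisymm (PadicInt.norm_le_one x) (not_lt.1 h)

lemma sqs_neg (x : ℤ_[p]) (h : ¬ (p : ℤ_[p]) ∣ x) : sqs (-x) = -x := by
  simp [sqs, h]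

lemma G_rec {G : ℤ_[p] → ℤ_[p]} (hGcont : Continuous G)
    (hGval : ∀ n : ℕ, G n =
      (-1) ^ n * ∏ k ∈ (Finset.range n).filter (fun k => ¬ p ∣ k), (k : ℤ_[p])) (x : ℤ_[p]) :
    G (x + 1) = -sqs x * G x := by
  have hnat : ∀ n : ℕ, G (n + 1) = -sqs (n : ℤ_[p]) * G n := by
    intro n
    have h1 := hGval (n + 1)
    rw [prod_filter, prod_range_succ, ← prod_filter, pow_succ] at h1
    push_cast at h1
    rw [h1, hGval n, sqs]
    simp only [natCast_p_dvd]
    split_ifs <;> first | contradiction | ring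
  have hx := PadicInt.sub_zmodRepr_mem x
  rw [PadicInt.maximalIdeal_eq_span_p, Ideal.mem_span_singleton] at hx
  obtain ⟨y, hy⟩ := hx
  set i := x.zmodRepr
  have hx : x = i + p * y := by linear_combination hy
  have key : (fun y : ℤ_[p] => G ((i + p * y) + 1)) =
      fun y => -(if p ∣ i then 1 else (i + p * y : ℤ_[p])) * G (i + p * y) := by
    refine PadicInt.denseRange_natCast.equalizer (hGcont.comp (by fun_prop)) ?_ ?_
    · refine Continuous.mul ?_ (hGcont.comp (by fun_prop))
      split_ifs <;> fun_prop
    · funext m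
      have := hnat (i + p * m)
      simp only [sqs, natCast_p_dvd, Nat.dvd_add_left (dvd_mul_right p m)] at this
      push_cast at this
      simpa using this
  have := congrFun key y
  beta_reduce at this
  rw [hx, this, sqs]
  have e : (p : ℤ_[p]) ∣ i + p * y ↔ p ∣ i := by
    rw [dvd_add_left (dvd_mul_right _ _), natCast_p_dvd]
  simp only [e]

lemma G_rec_n {G : ℤ_[p] → ℤ_[p]} (hG : ∀ x, G (x + 1) = -sqs x * G x) (x : ℤ_[p]) (n : ℕ) :
    G (x + n) = (-1) ^ n * (∏ i ∈ range n, sqs (x + (i : ℤ_[p]))) * G x := by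
  induction n with
  | zero => simp
  | succ n ih =>
    push_cast
    rw [← add_assoc, hG, ih, prod_range_succ]
    ring

lemma prod_X_add_C : ∏ a : ZMod p, (Polynomial.X + Polynomial.C a : Polynomial (ZMod p)) =
    Polynomial.X ^ p - Polynomial.X := by
  have h1 : ∏ a : ZMod p, (Polynomial.X + Polynomial.C a : Polynomial (ZMod p)) =
      ∏ a : ZMod p, (Polynomial.X - Polynomial.C a : Polynomial (ZMod p)) :=
    Fintype.prod_equiv (Equiv.neg _) _ _ (fun a => by simp)
  have h2 := FiniteField.roots_X_pow_card_sub_X (ZMod p)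
  rw [ZMod.card] at h2
  have hd := FiniteField.X_pow_card_sub_X_natDegree_eq (ZMod p) hp.out.one_lt
  have hm : (Polynomial.X ^ p - Polynomial.X : Polynomial (ZMod p)).Monic :=
    Polynomial.monic_X_pow_sub (by rw [Polynomial.degree_X]; exact_mod_cast hp.out.one_lt)
  have h3 := Polynomial.prod_multiset_X_sub_C_of_monic_of_roots_card_eq hm
    (by rw [h2, hd, ← Finset.card_def, Finset.card_univ, ZMod.card])
  rw [h2] at h3
  rw [h1, ← h3]
  rfl

lemma prod_range_zmod {M : Type*} [CommMonoid M] (g : ZMod p → M) :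
    ∏ i ∈ range p, g (i : ZMod p) = ∏ a : ZMod p, g a := by
  refine Finset.prod_bij (fun i _ => (i : ZMod p)) (by simp) ?_ ?_ (by simp)
  · intro a ha b hb h
    rw [ZMod.natCast_eq_natCast_iff'] at h
    rwa [Nat.mod_eq_of_lt (mem_range.1 ha), Nat.mod_eq_of_lt (mem_range.1 hb)] at h
  · intro b _
    exact ⟨b.val, mem_range.2 (ZMod.val_lt b), by simp⟩

lemma toZMod_eq_zero (x : ℤ_[p]) : PadicInt.toZMod x = 0 ↔ (p : ℤ_[p]) ∣ x := by
  rw [← RingHom.mem_ker, PadicInt.ker_toZMod, PadicInt.maximalIdeal_eq_span_p,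
    Ideal.mem_span_singleton]

open Classical in
lemma prod_poly (h5 : 5 ≤ p) (c : ℤ_[p]) : ∃ A B : Polynomial ℤ_[p],
    -∏ i ∈ range p, (if (p : ℤ_[p]) ∣ c + (i : ℤ_[p]) then 1 else Polynomial.X + Polynomial.C (c + (i : ℤ_[p]))) =
      1 + Polynomial.C (p : ℤ_[p]) * A + Polynomial.X ^ 4 * B := by
  set Q : Polynomial ℤ_[p] :=
    ∏ i ∈ range p, (if (p : ℤ_[p]) ∣ c + (i : ℤ_[p]) then 1 else Polynomial.X + Polynomial.C (c + (i : ℤ_[p]))) with hQ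
  have hmap : Q.map PadicInt.toZMod = Polynomial.X ^ (p - 1) - 1 := by
    have h1 : Q.map PadicInt.toZMod = ∏ i ∈ range p, (fun a : ZMod p => if PadicInt.toZMod c + a = 0
        then (1 : Polynomial (ZMod p)) else Polynomial.X + Polynomial.C (PadicInt.toZMod c + a))
          (i : ZMod p) := by
      rw [hQ, Polynomial.map_prod]
      refine prod_congr rfl fun i _ => ?_
      have : PadicInt.toZMod c + (i : ZMod p) = PadicInt.toZMod (c + (i : ℤ_[p])) := by simp
      simp only [this, toZMod_eq_zero]
      split_ifs
      · simp
      · simp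
    rw [prod_range_zmod (p := p) (fun a : ZMod p => if PadicInt.toZMod c + a = 0
        then (1 : Polynomial (ZMod p)) else Polynomial.X + Polynomial.C (PadicInt.toZMod c + a)), Fintype.prod_equiv (Equiv.addLeft (PadicInt.toZMod c)) _
      (fun a => if a = 0 then (1 : Polynomial (ZMod p)) else Polynomial.X + Polynomial.C a)
      (fun a => by simp)] at h1
    have h2 : Polynomial.X * Q.map PadicInt.toZMod = Polynomial.X * (Polynomial.X ^ (p - 1) - 1) := by
      rw [h1, mul_sub, ← pow_succ', Nat.sub_add_cancel (by omega), mul_one, ← prod_X_add_C]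
      rw [← Finset.mul_prod_erase univ _ (mem_univ (0 : ZMod p)),
        ← Finset.mul_prod_erase univ (fun a => Polynomial.X + Polynomial.C a) (mem_univ (0 : ZMod p))]
      simp only [if_true, one_mul, Polynomial.C_0, add_zero]
      congr 1
      refine prod_congr rfl fun a ha => ?_
      rw [if_neg (Finset.ne_of_mem_erase ha)]
    exact mul_left_cancel₀ Polynomial.X_ne_zero h2
  have h0 : (-Q - 1 + Polynomial.X ^ (p - 1)).map PadicInt.toZMod = 0 := by
    simp [hmap]
  have hdvd : Polynomial.C (p : ℤ_[p]) ∣ (-Q - 1 + Polynomial.X ^ (p - 1)) := by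
    rw [Polynomial.C_dvd_iff_dvd_coeff]
    intro i
    rw [← toZMod_eq_zero, ← Polynomial.coeff_map, h0]
    simp
  obtain ⟨A, hA⟩ := hdvd
  refine ⟨A, -Polynomial.X ^ (p - 5), ?_⟩
  rw [← hA, mul_neg, ← pow_add, show 4 + (p - 5) = p - 1 by omega]
  ring

lemma G_cls (h5 : 5 ≤ p) {G : ℤ_[p] → ℤ_[p]} (hGcont : Continuous G)
    (hG : ∀ x, G (x + 1) = -sqs x * G x) (c : ℤ_[p]) : SqCls (fun y => G (c + p * y)) := by
  classical
  obtain ⟨A, B, hAB⟩ := prod_poly h5 c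
  refine SqCls.of_rec (hGcont.comp (by fun_prop)) A B fun y => ?_
  have h := congrArg (Polynomial.eval ((p : ℤ_[p]) * y)) hAB
  simp only [Polynomial.eval_neg, Polynomial.eval_prod, Polynomial.eval_add, Polynomial.eval_one,
    Polynomial.eval_mul, Polynomial.eval_C, Polynomial.eval_pow, Polynomial.eval_X] at h
  rw [← h, show c + p * (y + 1) = c + p * y + (p : ℕ) by push_cast; ring, G_rec_n hG]
  have hodd : Odd p := hp.out.odd_of_ne_two (by omega)
  rw [hodd.neg_one_pow]
  congr 1
  rw [neg_one_mul]
  congr 1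
  refine prod_congr rfl fun i _ => ?_
  have e : (p : ℤ_[p]) ∣ c + p * y + (i : ℤ_[p]) ↔ (p : ℤ_[p]) ∣ c + (i : ℤ_[p]) := by
    rw [show c + p * y + (i : ℤ_[p]) = c + (i : ℤ_[p]) + p * y by ring, dvd_add_left (dvd_mul_right _ _)]
  simp only [sqs, e]
  split_ifs
  · simp
  · simp; ring

/-- `θ(k) = G(1/2+k) G(-k)` -/
noncomputable def sqth (G : ℤ_[p] → ℤ_[p]) (q : ℤ_[p]) (k : ℤ_[p]) : ℤ_[p] :=
  G (2 * q + k) * G (-k)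

lemma sqth_refl (G : ℤ_[p] → ℤ_[p]) (q : ℤ_[p]) (k : ℤ_[p]) :
    sqth G q (-(2 * q) - k) = sqth G q k := by
  unfold sqth
  rw [mul_comm]
  congr 2 <;> ring

lemma sqth_cls (h5 : 5 ≤ p) {G : ℤ_[p] → ℤ_[p]} (hGcont : Continuous G)
    (hG : ∀ x, G (x + 1) = -sqs x * G x) (q b : ℤ_[p]) : SqCls (fun a => sqth G q (p * a + b)) := by
  have h1 := G_cls h5 hGcont hG (2 * q + b)
  have h2 := (G_cls h5 hGcont hG (-b)).neg_arg
  convert h1.mul h2 using 2 with a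
  unfold sqth
  congr 2 <;> ring

lemma G_refl {G : ℤ_[p] → ℤ_[p]} (hG : ∀ x, G (x + 1) = -sqs x * G x) (hG0 : G 0 = 1) (k : ℕ) :
    G (1 + k) * G (-k) = -(-1) ^ (k - k / p) := by
  induction k with
  | zero =>
    have := hG 0
    simp [sqs, hG0] at this
    simp [hG0, this]
  | succ k ih =>
    have h1 := hG (1 + k)
    have h2 := hG (-(1 + k))
    rw [show -(1 + (k : ℤ_[p])) + 1 = -k by ring] at h2
    rw [show (1 : ℤ_[p]) + (k + 1 : ℕ) = 1 + k + 1 by push_cast; ring,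
      show -((k + 1 : ℕ) : ℤ_[p]) = -(1 + k) by push_cast; ring, h1]
    have e : (p : ℤ_[p]) ∣ 1 + k ↔ p ∣ k + 1 := by
      rw [← natCast_p_dvd]; push_cast; rw [add_comm]
    by_cases h : p ∣ k + 1
    · have h' := e.2 h
      have s1 : sqs (1 + (k : ℤ_[p])) = 1 := by simp [sqs, h']
      have s2 : sqs (-(1 + (k : ℤ_[p]))) = 1 := by simp only [sqs, dvd_neg, h', if_true]
      rw [s2] at h2
      rw [s1, Nat.succ_div_of_dvd h, show k + 1 - (k / p + 1) = k - k / p by omega, ← ih, h2]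
      ring
    · have h' : ¬ (p : ℤ_[p]) ∣ 1 + (k : ℤ_[p]) := fun x => h (e.1 x)
      have s1 : sqs (1 + (k : ℤ_[p])) = 1 + k := by unfold sqs; rw [if_neg h']
      rw [sqs_neg _ h'] at h2
      have : k / p ≤ k := Nat.div_le_self _ _
      rw [s1, Nat.succ_div_of_not_dvd h, show k + 1 - k / p = (k - k / p) + 1 by omega, pow_succ]
      rw [h2] at ih
      linear_combination -ih

lemma G_refl_pos (h5 : 5 ≤ p) {G : ℤ_[p] → ℤ_[p]} (hG : ∀ x, G (x + 1) = -sqs x * G x)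
    (hG0 : G 0 = 1) (a b : ℕ) (hb : b < p) :
    G (1 + (p * a + b : ℕ)) * G (-(p * a + b : ℕ)) = -(-1) ^ b := by
  rw [G_refl hG hG0]
  have hd : (p * a + b) / p = a := by
    rw [Nat.mul_add_div (by omega), Nat.div_eq_of_lt hb, add_zero]
  rw [hd]
  have hodd : Odd p := hp.out.odd_of_ne_two (by omega)
  obtain ⟨m, hm⟩ := hodd
  have : p * a + b - a = 2 * (m * a) + b := by
    rw [hm]; ring_nf; omega
  rw [this, pow_add, pow_mul]
  simp

lemma G_half_sq (h5 : 5 ≤ p) (hp4 : p % 4 = 1) {G : ℤ_[p] → ℤ_[p]} (hGcont : Continuous G)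
    (hG : ∀ x, G (x + 1) = -sqs x * G x)
    (hG0 : G 0 = 1) (q : ℤ_[p]) (hq : 4 * q = 1) : G (2 * q) ^ 2 = -1 := by
  obtain ⟨m, hm⟩ : ∃ m, p = 4 * m + 1 := ⟨p / 4, by omega⟩
  have key : (fun y : ℤ_[p] => G (1 + (p * y + (2 * m : ℕ))) * G (-(p * y + (2 * m : ℕ)))) =
      fun _ => -1 := by
    refine PadicInt.denseRange_natCast.equalizer ?_ continuous_const ?_
    · exact (hGcont.comp (by fun_prop)).mul (hGcont.comp (by fun_prop))
    · funext a
      have := G_refl_pos h5 hG hG0 a (2 * m) (by omega)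
      rw [pow_mul] at this
      push_cast at this ⊢
      simpa using this
  have := congrFun key (-(2 * q))
  beta_reduce at this
  have hm' : (p : ℤ_[p]) = 4 * m + 1 := by exact_mod_cast congrArg (Nat.cast (R := ℤ_[p])) hm
  have e1 : 1 + ((p : ℤ_[p]) * (-(2 * q)) + (2 * m : ℕ)) = 2 * q := by
    rw [hm']; push_cast; linear_combination (-2 * (m : ℤ_[p]) - 1) * hq
  have e2 : -((p : ℤ_[p]) * (-(2 * q)) + (2 * m : ℕ)) = 2 * q := by
    rw [hm']; push_cast; linear_combination (2 * (m : ℤ_[p])) * hq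
  rw [e1, e2] at this
  rw [sq, this]

end part4

open Finset

/-! ## Part 5: the block structure of the summands -/

section part5
variable {p : ℕ} [hp : Fact p.Prime]

/-- ratio of consecutive terms -/
noncomputable def sqsu (e : ℕ) (z : ℚ_[p]) (j : ℕ) : ℚ_[p] :=
  ((2 * j + 1) / (2 * j + 2)) ^ e * (1 - z / (2 * j + 1) ^ 2)

/-- terms -/
noncomputable def sqU (e : ℕ) (z : ℚ_[p]) (k : ℕ) : ℚ_[p] := ∏ j ∈ range k, sqsu e z j

/-- ratio of consecutive unit parts -/
noncomputable def sqqr (q : ℤ_[p]) (j : ℕ) : ℚ_[p] :=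
  (sqs (2 * q + (j : ℤ_[p])) : ℚ_[p]) / (sqs (1 + (j : ℤ_[p])) : ℚ_[p])

/-- unit part -/
noncomputable def sqqq (q : ℤ_[p]) (k : ℕ) : ℚ_[p] := ∏ j ∈ range k, sqqr q j

open Classical in
/-- ratio of consecutive terms without the multiples of `p` -/
noncomputable def sqsr (q : ℤ_[p]) (e : ℕ) (z : ℚ_[p]) (j : ℕ) : ℚ_[p] :=
  sqqr q j ^ e * (if p ∣ 2 * j + 1 then 1 else 1 - (p : ℚ_[p]) ^ 2 * z / (2 * j + 1) ^ 2)

/-- terms without the multiples of `p` -/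
noncomputable def sqR (q : ℤ_[p]) (e : ℕ) (z : ℚ_[p]) (k : ℕ) : ℚ_[p] := ∏ j ∈ range k, sqsr q e z j

lemma quarter_cast {q : ℤ_[p]} (hq : 4 * q = 1) : (q : ℚ_[p]) = 1 / 4 := by
  have h : (4 : ℚ_[p]) * q = 1 := by exact_mod_cast congrArg (fun x : ℤ_[p] => (x : ℚ_[p])) hq
  rw [eq_div_iff (by norm_num), mul_comm, h]

lemma coe_two_padic : ((2 : ℤ_[p]) : ℚ_[p]) = 2 := by
  have := PadicInt.coe_natCast (p := p) 2
  exact_mod_cast this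

lemma coe_prod_padic {ι : Type*} (s : Finset ι) (f : ι → ℤ_[p]) :
    ((∏ i ∈ s, f i : ℤ_[p]) : ℚ_[p]) = ∏ i ∈ s, (f i : ℚ_[p]) :=
  map_prod (PadicInt.Coe.ringHom (p := p)) f s

lemma half_dvd (h5 : 5 ≤ p) {q : ℤ_[p]} (hq : 4 * q = 1) (j : ℕ) :
    (p : ℤ_[p]) ∣ 2 * q + (j : ℤ_[p]) ↔ p ∣ 2 * j + 1 := by
  rw [← natCast_p_dvd, ← (two_unit (p := p) h5).dvd_mul_left]
  have : (2 : ℤ_[p]) * (2 * q + (j : ℤ_[p])) = ((2 * j + 1 : ℕ) : ℤ_[p]) := by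
    push_cast; linear_combination hq
  rw [this]

lemma succ_dvd (j : ℕ) : (p : ℤ_[p]) ∣ 1 + (j : ℤ_[p]) ↔ p ∣ j + 1 := by
  rw [← natCast_p_dvd]; push_cast; rw [add_comm]

lemma sqs_half (h5 : 5 ≤ p) {q : ℤ_[p]} (hq : 4 * q = 1) (j : ℕ) (h : ¬ p ∣ 2 * j + 1) :
    (sqs (2 * q + (j : ℤ_[p])) : ℚ_[p]) = (2 * j + 1) / 2 := by
  unfold sqs
  rw [if_neg (by rwa [half_dvd h5 hq])]
  push_cast
  rw [quarter_cast hq, coe_two_padic]; ring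

lemma sqs_half' (h5 : 5 ≤ p) {q : ℤ_[p]} (hq : 4 * q = 1) (j : ℕ) (h : p ∣ 2 * j + 1) :
    (sqs (2 * q + (j : ℤ_[p])) : ℚ_[p]) = 1 := by
  unfold sqs
  rw [if_pos (by rwa [half_dvd h5 hq])]
  simp

lemma sqs_succ (j : ℕ) (h : ¬ p ∣ j + 1) :
    (sqs (1 + (j : ℤ_[p])) : ℚ_[p]) = j + 1 := by
  unfold sqs
  rw [if_neg (by rwa [succ_dvd])]
  push_cast; ring

lemma sqs_succ' (j : ℕ) (h : p ∣ j + 1) :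
    (sqs (1 + (j : ℤ_[p])) : ℚ_[p]) = 1 := by
  unfold sqs
  rw [if_pos (by rwa [succ_dvd])]
  simp

lemma odd_ne (j : ℕ) : (2 * (j : ℚ_[p]) + 1) ≠ 0 := by exact_mod_cast (by omega : 2 * j + 1 ≠ 0)
lemma succ_ne (j : ℕ) : ((j : ℚ_[p]) + 1) ≠ 0 := by exact_mod_cast (by omega : j + 1 ≠ 0)
lemma ev_ne (j : ℕ) : (2 * (j : ℚ_[p]) + 2) ≠ 0 := by exact_mod_cast (by omega : 2 * j + 2 ≠ 0)

lemma step_reg (h5 : 5 ≤ p) {q : ℤ_[p]} (hq : 4 * q = 1) (e : ℕ) (z : ℚ_[p]) (j : ℕ)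
    (h1 : ¬ p ∣ 2 * j + 1) (h2 : ¬ p ∣ j + 1) : sqsu e ((p : ℚ_[p]) ^ 2 * z) j = sqsr q e z j := by
  rw [sqsu, sqsr, sqqr, sqs_half h5 hq j h1, sqs_succ j h2, if_neg h1]
  have := succ_ne (p := p) j
  congr 2
  rw [div_div]
  congr 1; ring

lemma step_half (h5 : 5 ≤ p) {q : ℤ_[p]} (hq : 4 * q = 1) (e : ℕ) (z : ℚ_[p]) (m a : ℕ)
    (hm : p = 2 * m + 1) :
    sqsu e ((p : ℚ_[p]) ^ 2 * z) (p * a + m) =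
      sqsu e z a * ((p : ℚ_[p]) * ((a : ℚ_[p]) + 1)) ^ e * sqsr q e z (p * a + m) := by
  have e1 : 2 * (p * a + m) + 1 = p * (2 * a + 1) := by rw [mul_add p, mul_left_comm p]; omega
  have h1 : p ∣ 2 * (p * a + m) + 1 := ⟨_, e1⟩
  have h2 : ¬ p ∣ (p * a + m) + 1 := by
    rw [add_assoc, Nat.dvd_add_right (dvd_mul_right _ _)]
    exact Nat.not_dvd_of_pos_of_lt (by omega) (by omega)
  rw [sqsu, sqsr, sqqr, sqs_half' h5 hq _ h1, sqs_succ _ h2, if_pos h1, sqsu]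
  have e2 : 2 * ((p * a + m : ℕ) : ℚ_[p]) + 1 = p * (2 * a + 1) := by exact_mod_cast e1
  have hp0 : (p : ℚ_[p]) ≠ 0 := by exact_mod_cast hp.out.ne_zero
  have n1 := odd_ne (p := p) a
  have n2 := succ_ne (p := p) a
  have n3 := succ_ne (p := p) (p * a + m)
  have n4 := ev_ne (p := p) a
  rw [e2]
  have e3 : (p : ℚ_[p]) ^ 2 * z / (p * (2 * a + 1)) ^ 2 = z / (2 * a + 1) ^ 2 := by
    field_simp
  rw [e3, mul_one]
  have e4 : (p : ℚ_[p]) * (2 * a + 1) / (2 * ((p * a + m : ℕ) : ℚ_[p]) + 2) =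
    (2 * a + 1) / (2 * a + 2) * (p * (a + 1)) * (1 / (((p * a + m : ℕ) : ℚ_[p]) + 1)) := by
    have : (2 * ((p * a + m : ℕ) : ℚ_[p]) + 2) = 2 * (((p * a + m : ℕ) : ℚ_[p]) + 1) := by ring
    rw [this, show (2 * (a : ℚ_[p]) + 2) = 2 * (a + 1) by ring]
    field_simp
  rw [e4, mul_pow, mul_pow]
  ring

lemma step_full (h5 : 5 ≤ p) {q : ℤ_[p]} (hq : 4 * q = 1) (e : ℕ) (z : ℚ_[p]) (m a : ℕ)
    (hm : p = 2 * m + 1) :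
    ((p : ℚ_[p]) * ((a : ℚ_[p]) + 1)) ^ e * sqsu e ((p : ℚ_[p]) ^ 2 * z) (p * a + 2 * m) =
      sqsr q e z (p * a + 2 * m) := by
  have e1 : (p * a + 2 * m) + 1 = p * (a + 1) := by rw [mul_add]; omega
  have h1 : p ∣ (p * a + 2 * m) + 1 := ⟨_, e1⟩
  have h2 : ¬ p ∣ 2 * (p * a + 2 * m) + 1 := by
    intro h
    rw [show 2 * (p * a + 2 * m) + 1 = p * (2 * a + 1) + 2 * m by rw [mul_add]; lia,
      Nat.dvd_add_right (dvd_mul_right _ _)] at h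
    exact Nat.not_dvd_of_pos_of_lt (by omega) (by omega) h
  rw [sqsu, sqsr, sqqr, sqs_half h5 hq _ h2, sqs_succ' _ h1, if_neg h2]
  have e2 : ((p * a + 2 * m : ℕ) : ℚ_[p]) + 1 = p * (a + 1) := by exact_mod_cast e1
  have hp0 : (p : ℚ_[p]) ≠ 0 := by exact_mod_cast hp.out.ne_zero
  have n2 := succ_ne (p := p) a
  rw [← mul_assoc, ← mul_pow]
  congr 2
  rw [show 2 * ((p * a + 2 * m : ℕ) : ℚ_[p]) + 2 = 2 * (((p * a + 2 * m : ℕ) : ℚ_[p]) + 1) by ring, e2]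
  field_simp

lemma run_reg (h5 : 5 ≤ p) {q : ℤ_[p]} (hq : 4 * q = 1) (e : ℕ) (z X : ℚ_[p]) (k n : ℕ)
    (h : ∀ c < n, ¬ p ∣ 2 * (k + c) + 1 ∧ ¬ p ∣ k + c + 1)
    (h0 : sqU e ((p : ℚ_[p]) ^ 2 * z) k = X * sqR q e z k) :
    sqU e ((p : ℚ_[p]) ^ 2 * z) (k + n) = X * sqR q e z (k + n) := by
  induction n with
  | zero => exact h0
  | succ n ih =>
    have ih := ih fun c hc => h c (by omega)
    obtain ⟨a, b⟩ := h n (by omega)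
    rw [← add_assoc, sqU, sqR, prod_range_succ, prod_range_succ, ← sqU, ← sqR, ih,
      step_reg h5 hq e z _ a b, mul_assoc]

lemma block_pos_aux (h5 : 5 ≤ p) {q : ℤ_[p]} (hq : 4 * q = 1) (e : ℕ) (z : ℚ_[p]) (m a b : ℕ)
    (hm : p = 2 * m + 1) (hb : b ≤ m)
    (h0 : sqU e ((p : ℚ_[p]) ^ 2 * z) (p * a) = sqU e z a * sqR q e z (p * a)) :
    sqU e ((p : ℚ_[p]) ^ 2 * z) (p * a + b) = sqU e z a * sqR q e z (p * a + b) := by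
  refine run_reg h5 hq e z _ _ b (fun c hc => ⟨?_, ?_⟩) h0
  · rw [show 2 * (p * a + c) + 1 = p * (2 * a) + (2 * c + 1) by ring,
      Nat.dvd_add_right (dvd_mul_right _ _)]
    exact Nat.not_dvd_of_pos_of_lt (by omega) (by omega)
  · rw [add_assoc, Nat.dvd_add_right (dvd_mul_right _ _)]
    exact Nat.not_dvd_of_pos_of_lt (by omega) (by omega)

lemma block_neg_aux (h5 : 5 ≤ p) {q : ℤ_[p]} (hq : 4 * q = 1) (e : ℕ) (z : ℚ_[p]) (m a c : ℕ)
    (hm : p = 2 * m + 1) (hc : c < m)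
    (h0 : sqU e ((p : ℚ_[p]) ^ 2 * z) (p * a) = sqU e z a * sqR q e z (p * a)) :
    sqU e ((p : ℚ_[p]) ^ 2 * z) (p * a + m + 1 + c) =
      sqU e z (a + 1) * ((p : ℚ_[p]) * ((a : ℚ_[p]) + 1)) ^ e * sqR q e z (p * a + m + 1 + c) := by
  refine run_reg h5 hq e z _ _ c (fun c' hc' => ⟨?_, ?_⟩) ?_
  · rw [show 2 * (p * a + m + 1 + c') + 1 = p * (2 * a + 1) + (2 * c' + 2) by rw [mul_add]; lia,
      Nat.dvd_add_right (dvd_mul_right _ _)]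
    exact Nat.not_dvd_of_pos_of_lt (by omega) (by omega)
  · rw [show p * a + m + 1 + c' + 1 = p * a + (m + 1 + c' + 1) by ring,
      Nat.dvd_add_right (dvd_mul_right _ _)]
    exact Nat.not_dvd_of_pos_of_lt (by omega) (by omega)
  · have h1 := block_pos_aux h5 hq e z m a m hm le_rfl h0
    rw [sqU, sqR, prod_range_succ, prod_range_succ, ← sqU, ← sqR, h1, step_half h5 hq e z m a hm,
      sqU, sqU, prod_range_succ]
    ring

lemma block_zero (h5 : 5 ≤ p) {q : ℤ_[p]} (hq : 4 * q = 1) (e : ℕ) (z : ℚ_[p]) (m a : ℕ)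
    (hm : p = 2 * m + 1) :
    sqU e ((p : ℚ_[p]) ^ 2 * z) (p * a) = sqU e z a * sqR q e z (p * a) := by
  induction a with
  | zero => simp [sqU, sqR]
  | succ a ih =>
    have h1 := block_neg_aux h5 hq e z m a (m - 1) hm (by omega) ih
    rw [show p * a + m + 1 + (m - 1) = p * a + 2 * m by omega] at h1
    rw [show p * (a + 1) = p * a + 2 * m + 1 by rw [mul_add]; omega]
    rw [sqU, sqR, prod_range_succ, prod_range_succ, ← sqU, ← sqR, h1, ← step_full h5 hq e z m a hm]
    ring

lemma block_pos (h5 : 5 ≤ p) {q : ℤ_[p]} (hq : 4 * q = 1) (e : ℕ) (z : ℚ_[p]) (m a b : ℕ)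
    (hm : p = 2 * m + 1) (hb : b ≤ m) :
    sqU e ((p : ℚ_[p]) ^ 2 * z) (p * a + b) = sqU e z a * sqR q e z (p * a + b) :=
  block_pos_aux h5 hq e z m a b hm hb (block_zero h5 hq e z m a hm)

lemma block_neg (h5 : 5 ≤ p) {q : ℤ_[p]} (hq : 4 * q = 1) (e : ℕ) (z : ℚ_[p]) (m a c : ℕ)
    (hm : p = 2 * m + 1) (hc : c < m) :
    sqU e ((p : ℚ_[p]) ^ 2 * z) (p * a + m + 1 + c) =
      sqU e z (a + 1) * ((p : ℚ_[p]) * ((a : ℚ_[p]) + 1)) ^ e * sqR q e z (p * a + m + 1 + c) :=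
  block_neg_aux h5 hq e z m a c hm hc (block_zero h5 hq e z m a hm)

lemma sum_block (m M : ℕ) (hm : p = 2 * m + 1) (F : ℕ → ℚ_[p]) :
    ∑ k ∈ range (p * M + m + 1), F k = ∑ a ∈ range (M + 1), ∑ b ∈ range (m + 1), F (p * a + b) +
      ∑ a ∈ range M, ∑ c ∈ range m, F (p * a + m + 1 + c) := by
  induction M with
  | zero => simp
  | succ M ih =>
    rw [show p * (M + 1) + m + 1 = p * M + m + 1 + m + (m + 1) by rw [mul_add]; omega,
      sum_range_add, sum_range_add, ih, sum_range_succ _ (M + 1),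
      sum_range_succ (fun a => ∑ c ∈ range m, F (p * a + m + 1 + c)) M]
    rw [show p * M + m + 1 + m = p * (M + 1) by rw [mul_add]; omega]
    ring

/-- `x` is a multiple of `p^s` -/
def Cg (s : ℕ) (x : ℚ_[p]) : Prop := ∃ c : ℤ_[p], x = (p : ℚ_[p]) ^ s * c

lemma Cg.add {s : ℕ} {x y : ℚ_[p]} (hx : Cg s x) (hy : Cg s y) : Cg s (x + y) := by
  obtain ⟨c, rfl⟩ := hx
  obtain ⟨d, rfl⟩ := hy
  exact ⟨c + d, by push_cast; ring⟩

lemma Cg.neg {s : ℕ} {x : ℚ_[p]} (hx : Cg s x) : Cg s (-x) := by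
  obtain ⟨c, rfl⟩ := hx
  exact ⟨-c, by push_cast; ring⟩

lemma Cg.sub {s : ℕ} {x y : ℚ_[p]} (hx : Cg s x) (hy : Cg s y) : Cg s (x - y) := by
  rw [sub_eq_add_neg]; exact hx.add hy.neg

lemma Cg.mul {s t : ℕ} {x y : ℚ_[p]} (hx : Cg s x) (hy : Cg t y) : Cg (s + t) (x * y) := by
  obtain ⟨c, rfl⟩ := hx
  obtain ⟨d, rfl⟩ := hy
  exact ⟨c * d, by push_cast; ring⟩

lemma Cg.int (c : ℤ_[p]) : Cg 0 (c : ℚ_[p]) := ⟨c, by simp⟩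

lemma Cg.imul {s : ℕ} {x y : ℚ_[p]} (hx : Cg 0 x) (hy : Cg s y) : Cg s (x * y) := by
  have := hx.mul hy
  rwa [zero_add] at this

lemma Cg.muli {s : ℕ} {x y : ℚ_[p]} (hx : Cg s x) (hy : Cg 0 y) : Cg s (x * y) := hx.mul hy

lemma Cg.sum {ι : Type*} {s : ℕ} (t : Finset ι) (f : ι → ℚ_[p]) (h : ∀ i ∈ t, Cg s (f i)) :
    Cg s (∑ i ∈ t, f i) := by
  classical
  induction t using Finset.induction_on with
  | empty => exact ⟨0, by simp⟩
  | insert a t ha ih =>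
    rw [sum_insert ha]
    exact (h a (mem_insert_self _ _)).add (ih fun i hi => h i (mem_insert_of_mem hi))

lemma Cg.mono {s t : ℕ} {x : ℚ_[p]} (hx : Cg s x) (h : t ≤ s) : Cg t x := by
  obtain ⟨c, rfl⟩ := hx
  obtain ⟨d, rfl⟩ := Nat.exists_eq_add_of_le h
  exact ⟨p ^ d * c, by push_cast; ring⟩

lemma Cg.of_dvd {s : ℕ} {x : ℤ_[p]} (h : (p : ℤ_[p]) ^ s ∣ x) : Cg s (x : ℚ_[p]) := by
  obtain ⟨c, rfl⟩ := h
  exact ⟨c, by push_cast; ring⟩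

lemma Cg.of_norm {x : ℚ_[p]} (h : ‖x‖ ≤ 1) : Cg 0 x := ⟨⟨x, h⟩, by simp⟩

lemma Cg.norm_le {s : ℕ} {x : ℚ_[p]} (h : Cg s x) : ‖x‖ ≤ (p : ℝ) ^ (-(s : ℤ)) := by
  obtain ⟨c, rfl⟩ := h
  rw [norm_mul, norm_pow, Padic.norm_p, zpow_neg, zpow_natCast, inv_pow]
  exact mul_le_of_le_one_right (by positivity) c.2

lemma sqqr_norm (q : ℤ_[p]) (j : ℕ) : ‖sqqr q j‖ = 1 := by
  have h1 := sqs_norm (2 * q + (j : ℤ_[p]))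
  have h2 := sqs_norm (1 + (j : ℤ_[p]))
  rw [PadicInt.norm_def] at h1 h2
  rw [sqqr, norm_div, h1, h2, div_one]

lemma sqqq_norm (q : ℤ_[p]) (k : ℕ) : ‖sqqq q k‖ = 1 := by
  rw [sqqq, norm_prod]
  exact prod_eq_one fun j _ => sqqr_norm q j

/-- `R` against the unit part -/
lemma sqR_eq (q : ℤ_[p]) (e s : ℕ) (z0 : ℤ_[p]) (k : ℕ) :
    Cg (s + 2) (sqR q e ((p : ℚ_[p]) ^ s * z0) k - sqqq q k ^ e) := by
  induction k with
  | zero => exact ⟨0, by simp [sqR, sqqq]⟩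
  | succ k ih =>
    rw [sqR, sqqq, prod_range_succ, prod_range_succ, ← sqR, ← sqqq, sqsr, mul_pow]
    set R := sqR q e ((p : ℚ_[p]) ^ s * z0) k
    set w : ℚ_[p] := (if p ∣ 2 * k + 1 then 1 else
      1 - (p : ℚ_[p]) ^ 2 * ((p : ℚ_[p]) ^ s * z0) / (2 * k + 1) ^ 2) with hw
    have hi : Cg 0 (sqqr q k ^ e) := Cg.of_norm (by rw [norm_pow, sqqr_norm, one_pow])
    have hR : Cg 0 R := by
      have h1 : Cg 0 (sqqq q k ^ e) := Cg.of_norm (by rw [norm_pow, sqqq_norm, one_pow])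
      have := (ih.mono (Nat.zero_le _)).add h1
      rwa [sub_add_cancel] at this
    have h1 : Cg (s + 2) (w - 1) := by
      rw [hw]
      split_ifs with h
      · exact ⟨0, by simp⟩
      · have hn : ‖(1 / (2 * k + 1) : ℚ_[p])‖ = 1 := by
          have : ‖((2 * k + 1 : ℕ) : ℤ_[p])‖ = 1 := by
            refine le_antisymm (PadicInt.norm_le_one _) (not_lt.1 ?_)
            rwa [PadicInt.norm_natCast_lt_one_iff]
          rw [PadicInt.norm_def, PadicInt.coe_natCast] at this
          push_cast at this
          rw [norm_div, this]; simp
        obtain ⟨c, hc⟩ := Cg.of_norm hn.le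
        refine ⟨-z0 * c ^ 2, ?_⟩
        rw [pow_zero, one_mul] at hc
        push_cast
        rw [← hc, div_pow]
        ring
    have : R * (sqqr q k ^ e * w) - sqqq q k ^ e * sqqr q k ^ e =
      sqqr q k ^ e * (R * (w - 1) + (R - sqqq q k ^ e)) := by ring
    rw [this]
    exact hi.imul ((hR.imul h1).add ih)

lemma sqqq_G {G : ℤ_[p] → ℤ_[p]} (hG : ∀ x, G (x + 1) = -sqs x * G x) (hG0 : G 0 = 1)
    (q : ℤ_[p]) (hk2 : G (2 * q) ^ 2 = -1) (k : ℕ) (ε : ℤ_[p]) (hε : ε ^ 2 = 1)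
    (h : G (1 + (k : ℕ)) * G (-(k : ℕ)) = -ε) :
    sqqq q k = ((-ε * G (2 * q) * sqth G q k : ℤ_[p]) : ℚ_[p]) := by
  have h1 := G_rec_n hG (2 * q) k
  have h2 := G_rec_n hG 1 k
  have hG1 : G 1 = -1 := by
    have := hG 0
    simp only [zero_add, sqs, dvd_zero, if_true, hG0] at this
    simpa using this
  rw [hG1] at h2
  have hq : sqqq q k = ((∏ i ∈ range k, sqs (2 * q + (i : ℤ_[p])) : ℤ_[p]) : ℚ_[p]) /
      ((∏ i ∈ range k, sqs (1 + (i : ℤ_[p])) : ℤ_[p]) : ℚ_[p]) := by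
    rw [sqqq]
    rw [coe_prod_padic, coe_prod_padic, ← prod_div_distrib]
    rfl
  set A := ∏ i ∈ range k, sqs (2 * q + (i : ℤ_[p]))
  set B := ∏ i ∈ range k, sqs (1 + (i : ℤ_[p]))
  have hB : (B : ℚ_[p]) ≠ 0 := by
    have : ‖(B : ℚ_[p])‖ = 1 := by
      simp only [B]
      rw [coe_prod_padic, norm_prod]
      exact prod_eq_one fun j _ => sqs_norm _
    intro h
    rw [h] at this
    simp at this
  rw [hq, div_eq_iff hB]
  have key : A = (-ε * G (2 * q) * sqth G q k) * B := by
    unfold sqth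
    rw [h1]
    rw [h2] at h
    have hs : ((-1 : ℤ_[p]) ^ k) ^ 2 = 1 := by rw [← pow_mul, mul_comm, pow_mul]; simp
    linear_combination (-A * hε + A * ε * h + ε * (-1 : ℤ_[p]) ^ k * A * B * G (-k) * hk2)
  rw [← PadicInt.coe_mul, ← key]

end part5

open Finset

/-! ## Part 6: the main congruence -/

section part6
variable {p : ℕ} [hp : Fact p.Prime]

/-- block sum, right half -/
noncomputable def sqdl (G : ℤ_[p] → ℤ_[p]) (q : ℤ_[p]) (m : ℕ) (a : ℤ_[p]) : ℤ_[p] :=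
  ∑ b ∈ range (m + 1), (-1) ^ b * sqth G q (p * a + (b : ℤ_[p])) ^ 3

/-- block sum, left half -/
noncomputable def sqgm (G : ℤ_[p] → ℤ_[p]) (q : ℤ_[p]) (m : ℕ) (a : ℤ_[p]) : ℤ_[p] :=
  ∑ c ∈ range m, (-1) ^ c * sqth G q (p * a + ((c : ℤ_[p]) - m)) ^ 3

lemma sqdl_cls (h5 : 5 ≤ p) {G : ℤ_[p] → ℤ_[p]} (hGcont : Continuous G)
    (hG : ∀ x, G (x + 1) = -sqs x * G x) (q : ℤ_[p]) (m : ℕ) : SqCls (sqdl G q m) :=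
  SqCls.sum _ (fun (b : ℕ) (a : ℤ_[p]) => (-1) ^ b * sqth G q (p * a + (b : ℤ_[p])) ^ 3) fun b _ =>
    (SqCls.const _).mul ((sqth_cls h5 hGcont hG q b).pow 3)

lemma sqgm_cls (h5 : 5 ≤ p) {G : ℤ_[p] → ℤ_[p]} (hGcont : Continuous G)
    (hG : ∀ x, G (x + 1) = -sqs x * G x) (q : ℤ_[p]) (m : ℕ) : SqCls (sqgm G q m) :=
  SqCls.sum _ (fun (c : ℕ) (a : ℤ_[p]) => (-1) ^ c * sqth G q (p * a + ((c : ℤ_[p]) - m)) ^ 3) fun _ _ =>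
    (SqCls.const _).mul ((sqth_cls h5 hGcont hG q _).pow 3)

lemma sqdl_refl (G : ℤ_[p] → ℤ_[p]) {q : ℤ_[p]} (hq : 4 * q = 1) {m : ℕ} (hm : p = 2 * m + 1)
    (hev : Even m) (a : ℤ_[p]) : sqdl G q m (-(2 * q) - a) = sqdl G q m a := by
  unfold sqdl
  rw [← sum_range_reflect]
  refine sum_congr rfl fun b hb => ?_
  have hb' : b ≤ m := by rw [mem_range] at hb; omega
  have hm' : (p : ℤ_[p]) = 2 * m + 1 := by exact_mod_cast congrArg (Nat.cast (R := ℤ_[p])) hm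
  rw [show m + 1 - 1 - b = m - b by omega, Nat.cast_sub hb', ← sqth_refl]
  congr 1
  · have h1 : (-1 : ℤ_[p]) ^ (m - b) * (-1) ^ b = 1 := by
      rw [← pow_add, Nat.sub_add_cancel hb', hev.neg_one_pow]
    have h2 : ((-1 : ℤ_[p]) ^ b) ^ 2 = 1 := by rw [← pow_mul, mul_comm, pow_mul]; simp
    linear_combination ((-1 : ℤ_[p]) ^ b) * h1 - (-1 : ℤ_[p]) ^ (m - b) * h2
  · congr 2
    rw [hm']
    linear_combination (m : ℤ_[p]) * hq

lemma sqgm_refl (G : ℤ_[p] → ℤ_[p]) {q : ℤ_[p]} (hq : 4 * q = 1) {m : ℕ} (hm : p = 2 * m + 1)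
    (hev : Even m) (a : ℤ_[p]) : sqgm G q m (2 * q - a) = -sqgm G q m a := by
  unfold sqgm
  rw [← sum_range_reflect, ← sum_neg_distrib]
  refine sum_congr rfl fun b hb => ?_
  have hb' : b < m := by rwa [mem_range] at hb
  have hm' : (p : ℤ_[p]) = 2 * m + 1 := by exact_mod_cast congrArg (Nat.cast (R := ℤ_[p])) hm
  rw [show m - 1 - b = m - (b + 1) by omega, Nat.cast_sub (Nat.succ_le_of_lt hb'), ← sqth_refl]
  have hsgn : (-1 : ℤ_[p]) ^ (m - (b + 1)) = -(-1) ^ b := by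
    have h1 : (-1 : ℤ_[p]) ^ (m - (b + 1)) * (-1) ^ (b + 1) = 1 := by
      rw [← pow_add, Nat.sub_add_cancel hb', hev.neg_one_pow]
    have h2 : ((-1 : ℤ_[p]) ^ b) ^ 2 = 1 := by rw [← pow_mul, mul_comm, pow_mul]; simp
    rw [pow_succ] at h1
    linear_combination (-(-1 : ℤ_[p]) ^ b) * h1 - (-1 : ℤ_[p]) ^ (m - (b + 1)) * h2
  have earg : -(2 * q) - ((p : ℤ_[p]) * (2 * q - a) + ((m : ℤ_[p]) - (b.succ : ℤ_[p]) - m)) =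
      p * a + ((b : ℤ_[p]) - m) := by
    rw [hm']
    push_cast
    linear_combination (-(m : ℤ_[p]) - 1) * hq
  rw [hsgn, earg, neg_mul]

lemma block_reduce (h5 : 5 ≤ p) {G : ℤ_[p] → ℤ_[p]} (hGcont : Continuous G)
    (hG : ∀ x, G (x + 1) = -sqs x * G x) {q : ℤ_[p]} (hq : 4 * q = 1) {m : ℕ} (hm : p = 2 * m + 1)
    (hev : Even m) (s : ℕ) : ∃ (μ : ℤ_[p]) (ψ : ℤ_[p] → ℤ_[p]), ∀ a,
      (p : ℤ_[p]) ^ s ∣ sqdl G q m a - p ^ 3 * a ^ 3 * sqgm G q m a -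
        (μ + (p : ℤ_[p]) ^ 2 * sqT q ψ a) := by
  set F : ℤ_[p] → ℤ_[p] := fun w => sqdl G q m (w + -q) + (-(2 * q)) *
    ((p * w + p * q) ^ 3 * sqgm G q m (w + (1 - q)) + (p * w + -(p * q)) ^ 3 * sqgm G q m (w + -q)) with hF
  have hFc : SqCls F := by
    refine ((sqdl_cls h5 hGcont hG q m).shift _).add ((SqCls.const _).mul (SqCls.add ?_ ?_))
    · exact ((SqStr.pX.add (SqStr.const _)).cls.pow 3).mul ((sqgm_cls h5 hGcont hG q m).shift _)
    · exact ((SqStr.pX.add (SqStr.const _)).cls.pow 3).mul ((sqgm_cls h5 hGcont hG q m).shift _)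
  have hFe : ∀ w, F (-w) = F w := by
    intro w
    simp only [hF]
    rw [show -w + -q = -(2 * q) - (w + -q) by ring, sqdl_refl G hq hm hev,
      show -w + (1 - q) = 2 * q - (w + -q) by linear_combination -hq, sqgm_refl G hq hm hev,
      show -(2 * q) - (w + -q) = 2 * q - (w + (1 - q)) by linear_combination -hq,
      sqgm_refl G hq hm hev]
    ring
  obtain ⟨μ, ψ, h⟩ := even_reduce h5 q hq hFc hFe s
  refine ⟨μ, fun a => 1 * ψ a + (2 * q * p) * sqgm G q m a, fun a => ?_⟩
  convert h a using 1
  rw [sqT_lin]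
  simp only [hF, sqT]
  rw [show a + q + -q = a by ring, show a + q + (1 - q) = a + 1 by ring]
  linear_combination (-p ^ 3 * a ^ 3 * sqgm G q m a) * hq * (-1)

/-- telescoping -/
lemma telescope (z : ℚ_[p]) (ψ : ℤ_[p] → ℤ_[p]) (K : ℕ) :
    ∑ a ∈ range (K + 1), sqU 3 z a * ((a + 1 / 2) * ((a + 1 / 2) ^ 2 - z / 4) * ψ (a + 1) -
      a ^ 3 * ψ a) = (K + 1 / 2) * ((K + 1 / 2) ^ 2 - z / 4) * sqU 3 z K * ψ (K + 1) := by
  induction K with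
  | zero => simp [sqU]
  | succ K ih =>
    have eU : sqU 3 z (K + 1) = sqU 3 z K * sqsu 3 z K := prod_range_succ _ _
    rw [sum_range_succ, ih, eU, sqsu]
    have n1 := odd_ne (p := p) K
    have n2 := succ_ne (p := p) K
    have e : (K + 1 : ℚ_[p]) ^ 3 * (((2 * K + 1) / (2 * K + 2)) ^ 3 * (1 - z / (2 * K + 1) ^ 2)) =
        (K + 1 / 2) * ((K + 1 / 2) ^ 2 - z / 4) := by
      rw [show (2 * K + 2 : ℚ_[p]) = 2 * (K + 1) by ring,
        show (K + 1 / 2 : ℚ_[p]) = (2 * K + 1) / 2 by ring]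
      generalize (2 * K + 1 : ℚ_[p]) = x at *
      generalize (K + 1 : ℚ_[p]) = y at *
      field_simp
      ring
    push_cast
    linear_combination (-sqU 3 z K * ψ (K + 1)) * e

lemma main_cong (h5 : 5 ≤ p) {G : ℤ_[p] → ℤ_[p]} (hGcont : Continuous G)
    (hG : ∀ x, G (x + 1) = -sqs x * G x) (hG0 : G 0 = 1)
    {q : ℤ_[p]} (hq : 4 * q = 1) {m : ℕ} (hm : p = 2 * m + 1)
    (hev : Even m) (hk2 : G (2 * q) ^ 2 = -1) (n M : ℕ) (hM : 2 * M + 1 = p ^ n) :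
    ∃ μ : ℤ_[p], ∀ z0 : ℤ_[p], (∀ a ≤ M, Cg 0 (sqU 3 ((p : ℚ_[p]) ^ (2 * n) * (z0 : ℚ_[p])) a)) →
      Cg (2 * n + 2) (∑ k ∈ range (p * M + m + 1), sqU 3 ((p : ℚ_[p]) ^ 2 * ((p : ℚ_[p]) ^ (2 * n) * (z0 : ℚ_[p]))) k
        - (μ : ℚ_[p]) * ∑ a ∈ range (M + 1), sqU 3 ((p : ℚ_[p]) ^ (2 * n) * (z0 : ℚ_[p])) a) := by
  obtain ⟨μ, ψ, hψ⟩ := block_reduce h5 hGcont hG hq hm hev (2 * n + 2)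
  refine ⟨G (2 * q) * μ, fun z0 hint => ?_⟩
  set z : ℚ_[p] := (p : ℚ_[p]) ^ (2 * n) * z0 with hz
  set κ := G (2 * q) with hκ
  have hp4 : (p : ℤ_[p]) = 2 * m + 1 := by exact_mod_cast congrArg (Nat.cast (R := ℤ_[p])) hm
  have hsgn : ∀ b : ℕ, ((-1 : ℤ_[p]) ^ b) ^ 2 = 1 := fun b => by
    rw [← pow_mul, mul_comm, pow_mul]; simp
  -- the unit parts
  have hpos : ∀ a b : ℕ, b ≤ m → Cg (2 * n + 2) (sqR q 3 z (p * a + b) -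
      ((κ * ((-1) ^ b * sqth G q (p * a + (b : ℤ_[p])) ^ 3) : ℤ_[p]) : ℚ_[p])) := by
    intro a b hb
    have h1 := sqqq_G hG hG0 q hk2 (p * a + b) ((-1) ^ b) (hsgn b)
      (G_refl_pos h5 hG hG0 a b (by omega))
    have h2 := sqR_eq q 3 (2 * n) z0 (p * a + b)
    rw [h1] at h2
    have e' : κ * ((-1) ^ b * sqth G q (p * a + (b : ℤ_[p])) ^ 3) =
        (-(-1) ^ b * κ * sqth G q ((p * a + b : ℕ) : ℤ_[p])) ^ 3 := by
      push_cast
      linear_combination (κ * (-1 : ℤ_[p]) ^ b * sqth G q (p * a + (b : ℤ_[p])) ^ 3) *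
        (hk2 + κ ^ 2 * hsgn b)
    rw [e', PadicInt.coe_pow]
    exact h2
  have hneg : ∀ a c : ℕ, c < m → Cg (2 * n + 2) (sqR q 3 z (p * a + m + 1 + c) +
      ((κ * ((-1) ^ c * sqth G q (p * (a + 1) + ((c : ℤ_[p]) - m)) ^ 3) : ℤ_[p]) : ℚ_[p])) := by
    intro a c hc
    have h0 := G_refl_pos h5 hG hG0 a (m + 1 + c) (by omega)
    rw [show p * a + (m + 1 + c) = p * a + m + 1 + c by ring, pow_add, pow_succ, hev.neg_one_pow] at h0
    have h1 := sqqq_G hG hG0 q hk2 (p * a + m + 1 + c) (-(-1) ^ c) (by rw [neg_sq, hsgn])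
      (by rw [h0]; ring)
    have h2 := sqR_eq q 3 (2 * n) z0 (p * a + m + 1 + c)
    rw [h1] at h2
    have e : ((p * a + m + 1 + c : ℕ) : ℤ_[p]) = p * (a + 1) + ((c : ℤ_[p]) - m) := by
      push_cast; linear_combination -hp4
    have e' : κ * ((-1) ^ c * sqth G q (p * (a + 1) + ((c : ℤ_[p]) - m)) ^ 3) =
        -(- -(-1) ^ c * κ * sqth G q ((p * a + m + 1 + c : ℕ) : ℤ_[p])) ^ 3 := by
      rw [e]
      linear_combination (κ * (-1 : ℤ_[p]) ^ c * sqth G q (p * (a + 1) + ((c : ℤ_[p]) - m)) ^ 3) *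
        (hk2 + κ ^ 2 * hsgn c)
    rw [e', PadicInt.coe_neg, PadicInt.coe_pow, ← sub_eq_add_neg]
    exact h2
  -- pos half
  have S1 : Cg (2 * n + 2) (∑ a ∈ range (M + 1), ∑ b ∈ range (m + 1),
      sqU 3 ((p : ℚ_[p]) ^ 2 * z) (p * a + b) -
      ∑ a ∈ range (M + 1), sqU 3 z a * ((κ * sqdl G q m a : ℤ_[p]) : ℚ_[p])) := by
    rw [← sum_sub_distrib]
    refine Cg.sum _ _ fun a ha => ?_
    have ha' : a ≤ M := by rw [mem_range] at ha; omega
    rw [sqdl, mul_sum, PadicInt.coe_sum, mul_sum, ← sum_sub_distrib]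
    refine Cg.sum _ _ fun b hb => ?_
    have hb' : b ≤ m := by rw [mem_range] at hb; omega
    rw [block_pos h5 hq 3 z m a b hm hb', ← mul_sub]
    exact (hint a ha').imul (hpos a b hb')
  have S2 : Cg (2 * n + 2) (∑ a ∈ range M, ∑ c ∈ range m,
      sqU 3 ((p : ℚ_[p]) ^ 2 * z) (p * a + m + 1 + c) +
      ∑ a ∈ range (M + 1), sqU 3 z a * ((κ * (p ^ 3 * a ^ 3 * sqgm G q m a) : ℤ_[p]) : ℚ_[p])) := by
    rw [sum_range_succ']
    simp only [Nat.cast_zero, ne_eq, OfNat.ofNat_ne_zero, not_false_eq_true, zero_pow, mul_zero,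
      zero_mul, PadicInt.coe_zero, add_zero]
    rw [← sum_add_distrib]
    refine Cg.sum _ _ fun a ha => ?_
    have ha' : a + 1 ≤ M := by rw [mem_range] at ha; omega
    have e : sqU 3 z (a + 1) * ((κ * (p ^ 3 * ((a + 1 : ℕ) : ℤ_[p]) ^ 3 * sqgm G q m ((a + 1 : ℕ) : ℤ_[p])) : ℤ_[p]) : ℚ_[p]) =
        sqU 3 z (a + 1) * ((p : ℚ_[p]) * ((a : ℚ_[p]) + 1)) ^ 3 *
          ((κ * sqgm G q m ((a + 1 : ℕ) : ℤ_[p]) : ℤ_[p]) : ℚ_[p]) := by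
      push_cast; ring
    rw [e, sqgm, mul_sum, PadicInt.coe_sum, mul_sum, ← sum_add_distrib]
    refine Cg.sum _ _ fun c hc => ?_
    rw [block_neg h5 hq 3 z m a c hm (mem_range.1 hc), ← mul_add]
    refine Cg.imul ?_ ?_
    · refine (hint _ ha').imul (s := 0) ⟨((p : ℤ_[p]) * ((a : ℤ_[p]) + 1)) ^ 3, by push_cast; ring⟩
    · push_cast
      exact_mod_cast hneg a c (mem_range.1 hc)
  -- exact terms
  have S3 : Cg (2 * n + 2) (∑ a ∈ range (M + 1), sqU 3 z a * (((sqdl G q m a - p ^ 3 * a ^ 3 * sqgm G q m a -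
        (μ + (p : ℤ_[p]) ^ 2 * sqT q ψ a) : ℤ_[p])) : ℚ_[p])) := by
    refine Cg.sum _ _ fun a ha => ?_
    have ha' : a ≤ M := by rw [mem_range] at ha; omega
    exact (hint a ha').imul (Cg.of_dvd (hψ a))
  have hPp : (2 * M + 1 : ℚ_[p]) = p ^ n := by exact_mod_cast congrArg (Nat.cast (R := ℚ_[p])) hM
  have hqc := quarter_cast hq
  have S4 : Cg (2 * n) (∑ a ∈ range (M + 1), sqU 3 z a * ((sqT q ψ a : ℤ_[p]) : ℚ_[p])) := by
    have ht := telescope z ψ M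
    have e : ∑ a ∈ range (M + 1), sqU 3 z a * ((sqT q ψ a : ℤ_[p]) : ℚ_[p]) =
        ∑ a ∈ range (M + 1), sqU 3 z a * ((a + 1 / 2) * ((a + 1 / 2) ^ 2 - z / 4) * ψ (a + 1) -
          a ^ 3 * ψ a) + ∑ a ∈ range (M + 1), z * (sqU 3 z a * ((q * (a + 2 * q) * ψ (a + 1) : ℤ_[p]) : ℚ_[p])) := by
      rw [← sum_add_distrib]
      refine sum_congr rfl fun a _ => ?_
      rw [sqT]
      push_cast
      rw [hqc, coe_two_padic]
      ring
    rw [e, ht]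
    refine Cg.add ?_ (Cg.sum _ _ fun a ha => ?_)
    · have : ((M : ℚ_[p]) + 1 / 2) * ((M + 1 / 2) ^ 2 - z / 4) * sqU 3 z M * ψ (M + 1) =
          sqU 3 z M * (p ^ (2 * n) * ((p ^ n * (2 * q) * (q * (1 - z0)) * ψ (M + 1) : ℤ_[p]) : ℚ_[p])) := by
        push_cast
        rw [hz, hqc, coe_two_padic, show (M : ℚ_[p]) + 1 / 2 = p ^ n / 2 by rw [← hPp]; ring]
        ring
      rw [this]
      exact (hint M le_rfl).imul ⟨_, rfl⟩
    · have ha' : a ≤ M := by rw [mem_range] at ha; omega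
      exact Cg.muli ⟨z0, hz⟩ ((hint a ha').imul (Cg.int _))
  have S5 : Cg (2 * n + 2) (∑ a ∈ range (M + 1), sqU 3 z a * ((sqT q ψ a : ℤ_[p]) : ℚ_[p]) * (p : ℚ_[p]) ^ 2) := by
    rw [← sum_mul]
    exact S4.mul ⟨1, by simp⟩
  rw [sum_block m M hm]
  have := (S1.add S2).add ((Cg.int κ).imul (S3.add S5))
  convert this using 1
  have e : ((κ * μ : ℤ_[p]) : ℚ_[p]) * ∑ a ∈ range (M + 1), sqU 3 z a =
      ∑ a ∈ range (M + 1), sqU 3 z a * ((κ * sqdl G q m a : ℤ_[p]) : ℚ_[p]) -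
      ∑ a ∈ range (M + 1), sqU 3 z a * ((κ * (p ^ 3 * a ^ 3 * sqgm G q m a) : ℤ_[p]) : ℚ_[p]) -
      κ * (∑ a ∈ range (M + 1), sqU 3 z a * (((sqdl G q m a - p ^ 3 * a ^ 3 * sqgm G q m a -
        (μ + (p : ℤ_[p]) ^ 2 * sqT q ψ a) : ℤ_[p])) : ℚ_[p]) +
        ∑ a ∈ range (M + 1), sqU 3 z a * ((sqT q ψ a : ℤ_[p]) : ℚ_[p]) * (p : ℚ_[p]) ^ 2) := by
    simp only [mul_sum, ← sum_sub_distrib, ← sum_add_distrib]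
    refine sum_congr rfl fun a _ => ?_
    push_cast
    ring
  rw [e]
  ring

end part6

open Finset

/-! ## Part 7: integrality, the WZ evaluation, and assembly -/

section part7
variable {p : ℕ} [hp : Fact p.Prime]

lemma sqU_succ (e : ℕ) (z : ℚ_[p]) (k : ℕ) : sqU e z (k + 1) = sqU e z k * sqsu e z k :=
  prod_range_succ _ _

lemma sqU_zero (e : ℕ) (z : ℚ_[p]) : sqU e z 0 = 1 := prod_range_zero _

lemma sqV_succ (k : ℕ) : (sqU 1 0 (k + 1) : ℚ_[p]) = sqU 1 0 k * ((2 * (k : ℚ_[p]) + 1) / (2 * (k : ℚ_[p]) + 2)) := by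
  rw [sqU_succ, sqsu]; simp

lemma sqV_int {q : ℤ_[p]} (hq : 4 * q = 1) (k : ℕ) :
    (sqU 1 0 k : ℚ_[p]) = ((k.centralBinom * q ^ k : ℤ_[p]) : ℚ_[p]) := by
  have hqc := quarter_cast hq
  induction k with
  | zero => simp [sqU]
  | succ k ih =>
    have h := congrArg (Nat.cast (R := ℚ_[p])) (Nat.succ_mul_centralBinom_succ k)
    have n2 := succ_ne (p := p) k
    rw [sqV_succ, ih]
    push_cast at h ⊢
    rw [hqc]
    have h' : (((k + 1).centralBinom : ℕ) : ℚ_[p]) =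
        2 * (2 * (k : ℚ_[p]) + 1) * (k.centralBinom : ℚ_[p]) / ((k : ℚ_[p]) + 1) := by
      rw [eq_div_iff n2, ← h]; ring
    rw [h', show (2 * (k : ℚ_[p]) + 2) = 2 * ((k : ℚ_[p]) + 1) by ring]
    field_simp
    ring

lemma sqV_Cg {q : ℤ_[p]} (hq : 4 * q = 1) (k : ℕ) : Cg 0 (sqU 1 0 k : ℚ_[p]) := by
  rw [sqV_int hq]; exact Cg.int _

lemma sqU3_zero (k : ℕ) : (sqU 3 0 k : ℚ_[p]) = sqU 1 0 k ^ 3 := by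
  rw [sqU, sqU, ← prod_pow]
  refine prod_congr rfl fun j _ => ?_
  simp [sqsu]

lemma sqsu_n (n : ℚ_[p]) (j : ℕ) : sqsu 3 ((2 * n + 1) ^ 2) j =
    (2 * (j : ℚ_[p]) + 1) / (2 * (j : ℚ_[p]) + 2) *
      (-((n - (j : ℚ_[p])) * (n + (j : ℚ_[p]) + 1)) / ((j : ℚ_[p]) + 1) ^ 2) := by
  have n1 := odd_ne (p := p) j
  have n2 := succ_ne (p := p) j
  have h : (n - (j : ℚ_[p])) * (n + (j : ℚ_[p]) + 1) =
      ((2 * n + 1) ^ 2 - (2 * (j : ℚ_[p]) + 1) ^ 2) / 4 := by ring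
  rw [sqsu, h, show (2 * (j : ℚ_[p]) + 2) = 2 * ((j : ℚ_[p]) + 1) by ring]
  generalize (2 * (j : ℚ_[p]) + 1) = x at *
  generalize ((j : ℚ_[p]) + 1) = y at *
  field_simp
  ring

lemma sqU_n_int {M : ℕ} (k : ℕ) (hk : k ≤ M) : (sqU 3 ((2 * (M : ℚ_[p]) + 1) ^ 2) k : ℚ_[p]) =
    sqU 1 0 k * ((-1 : ℚ_[p]) ^ k * (M.choose k : ℚ_[p]) * ((M + k).choose k : ℚ_[p])) := by
  induction k with
  | zero => simp [sqU]
  | succ k ih =>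
    have h1 := congrArg (Nat.cast (R := ℚ_[p])) (Nat.choose_succ_right_eq M k)
    have h2 := congrArg (Nat.cast (R := ℚ_[p])) (Nat.add_one_mul_choose_eq (M + k) k)
    have n2 := succ_ne (p := p) k
    push_cast [Nat.cast_sub (show k ≤ M by omega)] at h1 h2
    rw [sqU_succ, ih (by omega), sqV_succ, sqsu_n, ← add_assoc]
    have h1' : ((M.choose (k + 1) : ℕ) : ℚ_[p]) =
        (M.choose k : ℚ_[p]) * ((M : ℚ_[p]) - (k : ℚ_[p])) / ((k : ℚ_[p]) + 1) := by
      rw [eq_div_iff n2, h1]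
    have h2' : (((M + k + 1).choose (k + 1) : ℕ) : ℚ_[p]) =
        ((M : ℚ_[p]) + (k : ℚ_[p]) + 1) * ((M + k).choose k : ℚ_[p]) / ((k : ℚ_[p]) + 1) := by
      rw [eq_div_iff n2, h2]
    rw [h1', h2', pow_succ]
    field_simp
    ring

/-- falling-rising product -/
noncomputable def sqX (n : ℚ_[p]) (K : ℕ) : ℚ_[p] := ∏ j ∈ range K, ((n - (j : ℚ_[p])) * (n + (j : ℚ_[p]) + 1))

/-- weight -/
noncomputable def sqw (K : ℕ) : ℚ_[p] :=
  ∏ j ∈ range K, (-(2 * (j : ℚ_[p]) + 1) / ((2 * (j : ℚ_[p]) + 2) * ((j : ℚ_[p]) + 1) ^ 2))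

lemma sqX_succ (n : ℚ_[p]) (K : ℕ) : sqX n (K + 1) = sqX n K * ((n - (K : ℚ_[p])) * (n + (K : ℚ_[p]) + 1)) :=
  prod_range_succ _ _

lemma sqw_succ (K : ℕ) : (sqw (K + 1) : ℚ_[p]) =
    sqw K * (-(2 * (K : ℚ_[p]) + 1) / ((2 * (K : ℚ_[p]) + 2) * ((K : ℚ_[p]) + 1) ^ 2)) :=
  prod_range_succ _ _

lemma sqU_eq_X (n : ℚ_[p]) (K : ℕ) : sqU 3 ((2 * n + 1) ^ 2) K = sqw K * sqX n K := by
  rw [sqU, sqw, sqX, ← prod_mul_distrib]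
  refine prod_congr rfl fun j _ => ?_
  rw [sqsu_n, div_mul_div_comm, div_mul_eq_mul_div]
  congr 1; ring

lemma sqX_up (n : ℚ_[p]) (K : ℕ) :
    sqX (n + 2) (K + 1) = sqX (n + 1) K * ((n + (K : ℚ_[p]) + 2) * (n + (K : ℚ_[p]) + 3)) := by
  induction K with
  | zero => rw [sqX_succ]; simp only [sqX, prod_range_zero, Nat.cast_zero]; ring
  | succ K ih => rw [sqX_succ, ih, sqX_succ]; push_cast; ring

lemma sqX_down (n : ℚ_[p]) (K : ℕ) :
    sqX n (K + 1) = sqX (n + 1) K * ((n - (K : ℚ_[p])) * (n + 1 - (K : ℚ_[p]))) := by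
  induction K with
  | zero => rw [sqX_succ]; simp [sqX]
  | succ K ih => rw [sqX_succ, ih, sqX_succ]; push_cast; ring

lemma wz_partial (n : ℚ_[p]) (K : ℕ) :
    ∑ k ∈ range (K + 1), ((n + 2) ^ 2 * (sqw k * sqX (n + 2) k) - (n + 1) ^ 2 * (sqw k * sqX n k)) =
      (2 * n + 3) * (2 * (K : ℚ_[p]) + 1) * sqw K * sqX (n + 1) K := by
  induction K with
  | zero => simp [sqw, sqX]; ring
  | succ K ih =>
    have n2 := succ_ne (p := p) K
    rw [sum_range_succ, ih, sqX_up, sqX_down, sqX_succ, sqw_succ,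
      show (2 * (K : ℚ_[p]) + 2) = 2 * ((K : ℚ_[p]) + 1) by ring]
    push_cast
    field_simp
    ring

lemma sqX_nat_zero (n K : ℕ) (h : n < K) : sqX (n : ℚ_[p]) K = 0 :=
  prod_eq_zero (mem_range.2 h) (by simp)

/-- terminating sums -/
noncomputable def sqsum (n : ℕ) : ℚ_[p] := ∑ k ∈ range (n + 1), sqU 3 ((2 * (n : ℚ_[p]) + 1) ^ 2) k

lemma wz_rec (n : ℕ) : ((n : ℚ_[p]) + 2) ^ 2 * sqsum (n + 2) = ((n : ℚ_[p]) + 1) ^ 2 * sqsum n := by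
  have h := wz_partial (n : ℚ_[p]) (n + 2)
  have h0 : sqX ((n : ℚ_[p]) + 1) (n + 2) = 0 := by
    have := sqX_nat_zero (p := p) (n + 1) (n + 2) (by omega)
    rwa [Nat.cast_add, Nat.cast_one] at this
  rw [h0, mul_zero, sum_sub_distrib, ← mul_sum, ← mul_sum] at h
  have e1 : (sqsum (n + 2) : ℚ_[p]) = ∑ k ∈ range (n + 2 + 1), sqw k * sqX ((n : ℚ_[p]) + 2) k := by
    refine sum_congr rfl fun k _ => ?_
    rw [sqU_eq_X]; push_cast; rfl
  have e2 : (sqsum n : ℚ_[p]) = ∑ k ∈ range (n + 2 + 1), sqw k * sqX (n : ℚ_[p]) k := by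
    rw [sum_range_succ, sum_range_succ, sqX_nat_zero n (n + 2) (by omega),
      sqX_nat_zero n (n + 1) (by omega), mul_zero, mul_zero, add_zero, add_zero]
    exact sum_congr rfl fun k _ => sqU_eq_X _ _
  rw [e1, e2]
  linear_combination h

lemma sqsum_even (l : ℕ) : (sqsum (2 * l) : ℚ_[p]) = sqU 1 0 l ^ 2 := by
  induction l with
  | zero => simp [sqsum, sqU]
  | succ l ih =>
    have h := wz_rec (p := p) (2 * l)
    rw [ih] at h
    have n4 := ev_ne (p := p) l
    push_cast at h
    rw [sqV_succ, show 2 * (l + 1) = 2 * l + 2 by ring]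
    have : (sqsum (2 * l + 2) : ℚ_[p]) =
        (2 * (l : ℚ_[p]) + 1) ^ 2 * sqU 1 0 l ^ 2 / (2 * (l : ℚ_[p]) + 2) ^ 2 := by
      rw [eq_div_iff (pow_ne_zero 2 n4), ← h]; ring
    rw [this, mul_pow, div_pow]
    ring

lemma sqR_zero (q : ℤ_[p]) (k : ℕ) : sqR q 1 0 k = sqqq q k := by
  rw [sqR, sqqq]
  refine prod_congr rfl fun j _ => ?_
  simp [sqsr]

lemma sqV_step (h5 : 5 ≤ p) {q : ℤ_[p]} (hq : 4 * q = 1) (t l : ℕ) (ht : p = 4 * t + 1) :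
    (sqU 1 0 (p * l + t) : ℚ_[p]) = sqU 1 0 l * sqqq q (p * l + t) := by
  have := block_pos h5 hq 1 0 (2 * t) l t (by omega) (by omega)
  rwa [mul_zero, sqR_zero] at this

lemma sqV_norm (h5 : 5 ≤ p) {q : ℤ_[p]} (hq : 4 * q = 1) (t : ℕ) (ht : p = 4 * t + 1) (n : ℕ) :
    ∀ l, 4 * l + 1 = p ^ n → ‖(sqU 1 0 l : ℚ_[p])‖ = 1 := by
  induction n with
  | zero => intro l hl; have : l = 0 := by rw [pow_zero] at hl; omega
            subst this; rw [sqU_zero]; simp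
  | succ n ih =>
    intro l hl
    obtain ⟨l0, h0⟩ : ∃ l0, 4 * l0 + 1 = p ^ n := by
      have : p ^ n % 4 = 1 := by rw [Nat.pow_mod, show p % 4 = 1 by omega]; simp
      exact ⟨p ^ n / 4, by omega⟩
    have : l = p * l0 + t := by
      rw [pow_succ, ← h0] at hl
      have : (4 * l0 + 1) * p = 4 * (p * l0) + p := by ring
      omega
    rw [this, sqV_step h5 hq t l0 ht, norm_mul, ih l0 h0, sqqq_norm, one_mul]

lemma asc_eq (k : ℕ) : (asc (1 / 2) k) ^ 3 / (k.factorial : ℚ_[p]) ^ 3 = sqU 3 0 k := by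
  rw [sqU3_zero, ← div_pow]
  congr 1
  induction k with
  | zero => simp [asc, sqU]
  | succ k ih =>
    have n2 := succ_ne (p := p) k
    rw [sqV_succ, ← ih, asc, prod_range_succ, ← asc, Nat.factorial_succ]
    push_cast
    rw [show (2 * (k : ℚ_[p]) + 2) = 2 * ((k : ℚ_[p]) + 1) by ring]
    have : (k.factorial : ℚ_[p]) ≠ 0 := by exact_mod_cast k.factorial_ne_zero
    field_simp
    ring

lemma final_cong (h5 : 5 ≤ p) {G : ℤ_[p] → ℤ_[p]} (hGcont : Continuous G)
    (hG : ∀ x, G (x + 1) = -sqs x * G x) (hG0 : G 0 = 1)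
    {q : ℤ_[p]} (hq : 4 * q = 1) (t l n : ℕ) (ht : p = 4 * t + 1) (hl : 4 * l + 1 = p ^ n) :
    Cg (2 * n + 2) (∑ k ∈ range (2 * (p * l + t) + 1), sqU 3 0 k -
      (-(G q : ℚ_[p]) ^ 4) * ∑ k ∈ range (2 * l + 1), sqU 3 0 k) := by
  have hk2 : G (2 * q) ^ 2 = -1 := G_half_sq h5 (by omega) hGcont hG hG0 q hq
  have hpt : (p : ℤ_[p]) = 4 * t + 1 := by exact_mod_cast congrArg (Nat.cast (R := ℤ_[p])) ht
  have hlp : (4 * l + 1 : ℤ_[p]) = p ^ n := by exact_mod_cast congrArg (Nat.cast (R := ℤ_[p])) hl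
  have hlq : (4 * l + 1 : ℚ_[p]) = p ^ n := by exact_mod_cast congrArg (Nat.cast (R := ℚ_[p])) hl
  have hptq : (p : ℚ_[p]) = 4 * t + 1 := by exact_mod_cast congrArg (Nat.cast (R := ℚ_[p])) ht
  obtain ⟨μ, hμ⟩ := main_cong h5 hGcont hG hG0 hq (m := 2 * t) (by omega) (even_two_mul t) hk2 n (2 * l)
    (by omega)
  rw [show p * (2 * l) + 2 * t + 1 = 2 * (p * l + t) + 1 by ring] at hμ
  -- z = 0
  have H0 := hμ 0 (fun a _ => by
    rw [PadicInt.coe_zero, mul_zero, sqU3_zero, sqV_int hq, ← PadicInt.coe_pow]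
    exact Cg.int _)
  rw [PadicInt.coe_zero, mul_zero, mul_zero] at H0
  -- z = p^(2 * n)
  have ez : (p : ℚ_[p]) ^ (2 * n) * ((1 : ℤ_[p]) : ℚ_[p]) = (2 * ((2 * l : ℕ) : ℚ_[p]) + 1) ^ 2 := by
    push_cast
    rw [mul_one, mul_comm 2 n, pow_mul, ← hlq]; ring
  have H1 := hμ 1 (fun a ha => by
    rw [ez, sqU_n_int a ha]
    refine (sqV_Cg hq a).imul ⟨(-1) ^ a * (2 * l).choose a * (2 * l + a).choose a, ?_⟩
    push_cast
    simp)
  have ez2 : (p : ℚ_[p]) ^ 2 * (2 * ((2 * l : ℕ) : ℚ_[p]) + 1) ^ 2 =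
      (2 * ((2 * (p * l + t) : ℕ) : ℚ_[p]) + 1) ^ 2 := by
    push_cast
    rw [← mul_pow]
    congr 1
    linear_combination hptq
  rw [ez, ez2] at H1
  change Cg (2 * n + 2) (sqsum (2 * (p * l + t)) - (μ : ℚ_[p]) * sqsum (2 * l)) at H1
  rw [sqsum_even, sqsum_even, sqV_step h5 hq t l ht] at H1
  set k := p * l + t with hk
  have hsgn : ((-1 : ℤ_[p]) ^ t) ^ 2 = 1 := by rw [← pow_mul, mul_comm, pow_mul]; simp
  have hqq := sqqq_G hG hG0 q hk2 k ((-1) ^ t) hsgn (G_refl_pos h5 hG hG0 l t (by omega))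
  have hqq2 : sqqq q k ^ 2 = ((-sqth G q k ^ 2 : ℤ_[p]) : ℚ_[p]) := by
    have e' : (-(-1) ^ t * G (2 * q) * sqth G q k) ^ 2 = -sqth G q k ^ 2 := by
      linear_combination (sqth G q k ^ 2) * (hk2 + G (2 * q) ^ 2 * hsgn)
    rw [hqq, ← PadicInt.coe_pow, e']
  -- theta near -1/4
  have hth : (p : ℤ_[p]) ^ (2 * n + 2) ∣ sqth G q k - G q ^ 2 := by
    have h := even_near_zero h5 (sqth_cls h5 hGcont hG q (t - p * q)) (fun w => by
      rw [← sqth_refl G q (p * w + (t - p * q))]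
      congr 1
      rw [hpt]
      linear_combination -2 * (t : ℤ_[p]) * hq) n q
    have e1 : (p : ℤ_[p]) * (p ^ n * q) + (t - p * q) = k := by
      rw [← hlp, hk]
      push_cast
      linear_combination (p * l : ℤ_[p]) * hq
    have e2 : (p : ℤ_[p]) * 0 + (t - p * q) = -q := by
      rw [hpt]
      linear_combination (-t : ℤ_[p]) * hq
    rw [e1, e2] at h
    convert h using 2
    rw [sqth, neg_neg, show 2 * q + -q = q by ring, sq]
  have hd : Cg (2 * n + 2) ((G q ^ 4 - sqth G q k ^ 2 : ℤ_[p]) : ℚ_[p]) := by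
    refine Cg.of_dvd ?_
    have : G q ^ 4 - sqth G q k ^ 2 = (sqth G q k - G q ^ 2) * (-(sqth G q k + G q ^ 2)) := by ring
    rw [this]
    exact Dvd.dvd.mul_right hth _
  have hV := sqV_norm h5 hq t ht n l hl
  set V : ℚ_[p] := sqU 1 0 l with hVdef
  have hV0 : V ≠ 0 := by
    intro h; rw [h] at hV; simp at hV
  have hVi : Cg 0 ((V⁻¹) ^ 2) := Cg.of_norm (by rw [norm_pow, norm_inv, hV]; simp)
  have hmu : Cg (2 * n + 2) ((μ : ℚ_[p]) + (G q : ℚ_[p]) ^ 4) := by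
    have h := hd.sub (hVi.imul H1)
    convert h using 1
    rw [mul_pow, hqq2]
    push_cast
    field_simp
    ring
  have hS : Cg 0 (∑ k ∈ range (2 * l + 1), (sqU 3 0 k : ℚ_[p])) := by
    refine Cg.sum _ _ fun a _ => ?_
    rw [sqU3_zero, sqV_int hq, ← PadicInt.coe_pow]
    exact Cg.int _
  have := H0.add (hmu.muli hS)
  convert this using 1
  ring

end part7

/-- for a prime `p ≡ 1 (mod 4)` and `r ≥ 1`,
`∑_{k=0}^{(p^r-1)/2} (1/2)³_k/k!³ ≡ -Γₚ(1/4)⁴ ∑_{k=0}^{(p^{r-1}-1)/2} (1/2)³_k/k!³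
 (mod p^{r+1})`, with Morita's p-adic Gamma function characterized as the
continuous `G : ℤ_p → ℤ_p` satisfying `G(n) = (-1)^n ∏_{0<k<n, p∤k} k`. -/
theorem stmt13 (p : ℕ) [Fact p.Prime] (hp4 : p % 4 = 1) (r : ℕ) (hr : 0 < r)
    (G : ℤ_[p] → ℤ_[p]) (hGcont : Continuous G)
    (hGval : ∀ n : ℕ, G n =
      (-1) ^ n * ∏ k ∈ (Finset.range n).filter (fun k => ¬ p ∣ k), (k : ℤ_[p]))
    (quarter : ℤ_[p]) (hquarter : 4 * quarter = 1) :
    ‖(∑ k ∈ Finset.range ((p ^ r - 1) / 2 + 1),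
          (asc (1/2) k) ^ 3 / (k.factorial : ℚ_[p]) ^ 3)
      - (-(G quarter : ℚ_[p]) ^ 4)
          * ∑ k ∈ Finset.range ((p ^ (r - 1) - 1) / 2 + 1),
              (asc (1/2) k) ^ 3 / (k.factorial : ℚ_[p]) ^ 3‖
      ≤ (p : ℝ) ^ (-((r : ℤ) + 1)) := by
  have hpp : p.Prime := Fact.out
  have h5 : 5 ≤ p := by
    have := hpp.two_le
    omega
  obtain ⟨t, ht⟩ : ∃ t, p = 4 * t + 1 := ⟨p / 4, by omega⟩
  obtain ⟨n, rfl⟩ : ∃ n, r = n + 1 := ⟨r - 1, by omega⟩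
  obtain ⟨l, hl⟩ : ∃ l, 4 * l + 1 = p ^ n := by
    have : p ^ n % 4 = 1 := by rw [Nat.pow_mod, hp4]; simp
    exact ⟨p ^ n / 4, by omega⟩
  have hG := G_rec hGcont hGval
  have hG0 : G 0 = 1 := by simpa using hGval 0
  have h := final_cong h5 hGcont hG hG0 hquarter t l n ht hl
  simp only [asc_eq]
  have e1 : (p ^ (n + 1) - 1) / 2 = 2 * (p * l + t) := by
    have : p ^ (n + 1) = 4 * (p * l) + p := by rw [pow_succ, ← hl]; ring
    omega
  have e2 : (p ^ (n + 1 - 1) - 1) / 2 = 2 * l := by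
    rw [Nat.add_sub_cancel]; omega
  rw [e1, e2]
  have h' := (h.mono (show n + 1 + 1 ≤ 2 * n + 2 by omega)).norm_le
  simpa using h'
end
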